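/- arXiv:1512.03272 — 4 statements merged into one kernel-verified Lean document; each statement's English description precedes it below -/
import Mathlib

section
/- For all positive integers a, b one has I_2(X;a,b) ≤ I_2(X;b,a)^{1/3} · I_1(X;a,b)^{2/3}. -/
/-- `Icount p X m a b ξ η` is the number of 12-tuples `(x₁,…,x₆,x₇,…,x₁₂)` of positive
integers `≤ X` (encoded as a pair of 6-tuples) satisfying
`x₁ʲ+⋯+x₆ʲ = x₇ʲ+⋯+x₁₂ʲ` for `j = 1,2,3`, with `xᵢ ≡ ξ (mod pᵃ)` for
`1 ≤ i ≤ m` and `7 ≤ i ≤ 6+m`, and `xᵢ ≡ η (mod pᵇ)` for the remaining indices. -/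
noncomputable def Icount (p : ℕ) (X : ℝ) (m a b : ℕ) (ξ η : ℤ) : ℕ :=
  Nat.card {xy : (Fin 6 → ℕ) × (Fin 6 → ℕ) //
    (∀ i, 1 ≤ xy.1 i ∧ (xy.1 i : ℝ) ≤ X) ∧
    (∀ i, 1 ≤ xy.2 i ∧ (xy.2 i : ℝ) ≤ X) ∧
    (∀ j ∈ Finset.Icc 1 3, ∑ i, xy.1 i ^ j = ∑ i, xy.2 i ^ j) ∧
    (∀ i : Fin 6, if (i : ℕ) < m then (xy.1 i : ℤ) ≡ ξ [ZMOD (p : ℤ) ^ a]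
      else (xy.1 i : ℤ) ≡ η [ZMOD (p : ℤ) ^ b]) ∧
    (∀ i : Fin 6, if (i : ℕ) < m then (xy.2 i : ℤ) ≡ ξ [ZMOD (p : ℤ) ^ a]
      else (xy.2 i : ℤ) ≡ η [ZMOD (p : ℤ) ^ b])}

/-- `Imax p X m a b` : for `m = 0`, the maximum of `Icount p X 0 a b ξ η` over residues
`η mod pᵇ` (it is independent of `ξ`); for `1 ≤ m ≤ 5`, the maximum of
`Icount p X m a b ξ η` over residues `ξ mod pᵃ`, `η mod pᵇ` with `ξ ≢ η (mod p)`. -/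
noncomputable def Imax (p : ℕ) (X : ℝ) (m a b : ℕ) : ℕ :=
  if m = 0 then sSup {n : ℕ | ∃ η : ℤ, n = Icount p X 0 a b 0 η}
  else sSup {n : ℕ | ∃ ξ η : ℤ, ¬ ξ ≡ η [ZMOD (p : ℤ)] ∧ n = Icount p X m a b ξ η}

open Finset in
/-- Orthogonality of characters: an even moment of exponential sums over a finite abelian group
counts the solutions of the corresponding additive equation. -/
theorem sum_addChar_prod_norm_sq {G ι α : Type*} [AddCommGroup G] [Fintype G] [DecidableEq G]
    [Fintype ι] [DecidableEq ι] (v : α → G) (S : ι → Finset α) :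
    ∑ ψ : AddChar G ℂ, ∏ i, ‖∑ x ∈ S i, ψ (v x)‖ ^ 2 =
      (Fintype.card G : ℝ) *
        #{fg ∈ Fintype.piFinset S ×ˢ Fintype.piFinset S |
          ∑ i, v (fg.1 i) = ∑ i, v (fg.2 i)} := by
  have expand (ψ : AddChar G ℂ) :
      (∏ i, ∑ x ∈ S i, ψ (v x)) = ∑ f ∈ Fintype.piFinset S, ψ (∑ i, v (f i)) := by
    rw [prod_univ_sum]
    exact sum_congr rfl fun f _ ↦
      (map_prod ψ.toMonoidHom (fun i ↦ Multiplicative.ofAdd (v (f i))) univ).symm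
  have norm_sq (ψ : AddChar G ℂ) :
      ((∏ i, ‖∑ x ∈ S i, ψ (v x)‖ ^ 2 : ℝ) : ℂ) =
        ∑ fg ∈ Fintype.piFinset S ×ˢ Fintype.piFinset S,
          ψ (∑ i, v (fg.1 i) - ∑ i, v (fg.2 i)) := by
    rw [prod_pow, ← norm_prod, expand, Complex.ofReal_pow, ← Complex.mul_conj', map_sum,
      sum_mul_sum, sum_product]
    refine sum_congr rfl fun f _ ↦ sum_congr rfl fun g _ ↦ ?_
    rw [sub_eq_add_neg, AddChar.map_add_eq_mul, AddChar.map_neg_eq_conj]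
  have key : ((∑ ψ : AddChar G ℂ, ∏ i, ‖∑ x ∈ S i, ψ (v x)‖ ^ 2 : ℝ) : ℂ) =
      (Fintype.card G : ℂ) *
        #{fg ∈ Fintype.piFinset S ×ˢ Fintype.piFinset S |
          ∑ i, v (fg.1 i) = ∑ i, v (fg.2 i)} := by
    rw [Complex.ofReal_sum, sum_congr rfl fun ψ _ ↦ norm_sq ψ, sum_comm]
    simp_rw [AddChar.sum_apply_eq_ite, sub_eq_zero]
    rw [← sum_filter, sum_const, nsmul_eq_mul, mul_comm]
  exact_mod_cast key

/-- The positive integers up to `M` in the residue class of `ξ` modulo `q`. -/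
def residueClass (M : ℕ) (q ξ : ℤ) : Finset ℕ :=
  {x ∈ Finset.Icc 1 M | (x : ℤ) ≡ ξ [ZMOD q]}

/-- The point `(x, x², x³)` of the moment curve modulo `N`. -/
def momentCurve (N : ℕ) (x : ℕ) : Fin 3 → ZMod N := fun j ↦ (x : ZMod N) ^ (j.1 + 1)

theorem sum_momentCurve_eq_iff {M N : ℕ} (hN : 6 * M ^ 3 < N) {f g : Fin 6 → ℕ}
    (hf : ∀ i, 1 ≤ f i ∧ f i ≤ M) (hg : ∀ i, 1 ≤ g i ∧ g i ≤ M) :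
    ∑ i, momentCurve N (f i) = ∑ i, momentCurve N (g i) ↔
      ∀ j ∈ Finset.Icc 1 3, ∑ i, f i ^ j = ∑ i, g i ^ j := by
  have bound {h : Fin 6 → ℕ} (hh : ∀ i, 1 ≤ h i ∧ h i ≤ M) {j : ℕ} (hj : j ≤ 3) :
      ∑ i, h i ^ j < N := by
    refine lt_of_le_of_lt ?_ hN
    calc ∑ i, h i ^ j ≤ ∑ _i : Fin 6, M ^ 3 := Finset.sum_le_sum fun i _ ↦
          (Nat.pow_le_pow_right (hh i).1 hj).trans (Nat.pow_le_pow_left (hh i).2 3)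
      _ = 6 * M ^ 3 := by simp
  have cast_iff {j : ℕ} (hj : j ≤ 3) :
      ∑ i, (f i : ZMod N) ^ j = ∑ i, (g i : ZMod N) ^ j ↔ ∑ i, f i ^ j = ∑ i, g i ^ j := by
    have := ZMod.natCast_eq_natCast_iff' (∑ i, f i ^ j) (∑ i, g i ^ j) N
    rw [Nat.mod_eq_of_lt (bound hf hj), Nat.mod_eq_of_lt (bound hg hj)] at this
    simpa only [Nat.cast_sum, Nat.cast_pow] using this
  simp only [funext_iff, Finset.sum_apply, momentCurve]
  constructor
  · intro h j hj
    obtain ⟨h1, h3⟩ := Finset.mem_Icc.mp hj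
    refine (cast_iff h3).mp ?_
    simpa only [Nat.sub_add_cancel h1] using h ⟨j - 1, by omega⟩
  · intro h j
    exact (cast_iff (by omega)).mpr (h _ (Finset.mem_Icc.mpr (by omega)))

open Finset in
theorem Icount_eq_card_filter {p : ℕ} {X : ℝ} (hX : 0 ≤ X) {N : ℕ} (hN : 6 * ⌊X⌋₊ ^ 3 < N)
    (m a b : ℕ) (ξ η : ℤ) (S : Fin 6 → Finset ℕ)
    (hS : ∀ i, S i = if i.1 < m then residueClass ⌊X⌋₊ (p ^ a) ξ
      else residueClass ⌊X⌋₊ (p ^ b) η) :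
    Icount p X m a b ξ η =
      #{fg ∈ Fintype.piFinset S ×ˢ Fintype.piFinset S |
        ∑ i, momentCurve N (fg.1 i) = ∑ i, momentCurve N (fg.2 i)} := by
  have mem_pi (f : Fin 6 → ℕ) : f ∈ Fintype.piFinset S ↔ (∀ i, 1 ≤ f i ∧ f i ≤ ⌊X⌋₊) ∧
      ∀ i : Fin 6, if (i : ℕ) < m then (f i : ℤ) ≡ ξ [ZMOD (p : ℤ) ^ a]
        else (f i : ℤ) ≡ η [ZMOD (p : ℤ) ^ b] := by
    rw [Fintype.mem_piFinset, ← forall_and]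
    refine forall_congr' fun i ↦ ?_
    rw [hS]
    split_ifs <;> simp [residueClass]
  refine Nat.subtype_card _ fun fg ↦ ?_
  simp only [mem_filter, mem_product, mem_pi, ← Nat.le_floor_iff hX]
  constructor
  · rintro ⟨⟨⟨hf, hf'⟩, hg, hg'⟩, h⟩
    exact ⟨hf, hg, (sum_momentCurve_eq_iff hN hf hg).mp h, hf', hg'⟩
  · rintro ⟨hf, hg, h, hf', hg'⟩
    exact ⟨⟨⟨hf, hf'⟩, hg, hg'⟩, (sum_momentCurve_eq_iff hN hf hg).mpr h⟩

/-- `Icount` as a mixed moment of exponential sums over residue classes. -/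
theorem sum_addChar_eq_mul_Icount {p : ℕ} {X : ℝ} (hX : 0 ≤ X) {N : ℕ} [NeZero N]
    (hN : 6 * ⌊X⌋₊ ^ 3 < N) (m a b : ℕ) (ξ η : ℤ) :
    ∑ ψ : AddChar (Fin 3 → ZMod N) ℂ, ∏ i : Fin 6,
        ‖if i.1 < m then ∑ x ∈ residueClass ⌊X⌋₊ (p ^ a) ξ, ψ (momentCurve N x)
          else ∑ x ∈ residueClass ⌊X⌋₊ (p ^ b) η, ψ (momentCurve N x)‖ ^ 2 =
      (Fintype.card (Fin 3 → ZMod N) : ℝ) * Icount p X m a b ξ η := by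
  rw [Icount_eq_card_filter hX hN m a b ξ η _ fun _ ↦ rfl, ← sum_addChar_prod_norm_sq]
  refine Finset.sum_congr rfl fun ψ _ ↦ Finset.prod_congr rfl fun i _ ↦ ?_
  split_ifs <;> rfl

/-- Hölder's inequality for mixed moments of two nonnegative functions. -/
theorem sum_pow_mul_pow_le_rpow_mul_rpow {ι : Type*} (s : Finset ι) {u v : ι → ℝ}
    (hu : ∀ i, 0 ≤ u i) (hv : ∀ i, 0 ≤ v i) :
    ∑ i ∈ s, u i ^ 2 * v i ^ 4 ≤
      (∑ i ∈ s, v i ^ 2 * u i ^ 4) ^ ((1 : ℝ) / 3) *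
        (∑ i ∈ s, u i * v i ^ 5) ^ ((2 : ℝ) / 3) := by
  have hpq : (3 : ℝ).HolderConjugate (3 / 2) := by
    rw [Real.holderConjugate_iff]; norm_num
  have h := Real.inner_le_Lp_mul_Lq_of_nonneg s hpq
    (f := fun i ↦ (v i ^ 2 * u i ^ 4) ^ ((1 : ℝ) / 3))
    (g := fun i ↦ (u i * v i ^ 5) ^ ((2 : ℝ) / 3))
    (fun i _ ↦ by have := hu i; have := hv i; positivity)
    (fun i _ ↦ by have := hu i; have := hv i; positivity)
  have hf (i : ι) : ((v i ^ 2 * u i ^ 4) ^ ((1 : ℝ) / 3)) ^ (3 : ℝ) = v i ^ 2 * u i ^ 4 := by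
    have := hu i
    have := hv i
    rw [← Real.rpow_mul (by positivity)]
    norm_num
  have hg (i : ι) : ((u i * v i ^ 5) ^ ((2 : ℝ) / 3)) ^ ((3 : ℝ) / 2) = u i * v i ^ 5 := by
    have := hu i
    have := hv i
    rw [← Real.rpow_mul (by positivity)]
    norm_num
  have hfg (i : ι) : (v i ^ 2 * u i ^ 4) ^ ((1 : ℝ) / 3) * (u i * v i ^ 5) ^ ((2 : ℝ) / 3) =
      u i ^ 2 * v i ^ 4 := by
    have h1 := hu i
    have h2 := hv i
    have split : (u i * v i ^ 5) ^ ((2 : ℝ) / 3) = ((u i * v i ^ 5) ^ 2) ^ ((1 : ℝ) / 3) := by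
      rw [← Real.rpow_natCast (_ * _) 2, ← Real.rpow_mul (by positivity)]
      norm_num
    rw [split, ← Real.mul_rpow (by positivity) (by positivity),
      show v i ^ 2 * u i ^ 4 * (u i * v i ^ 5) ^ 2 = (u i ^ 2 * v i ^ 4) ^ 3 by ring,
      ← Real.rpow_natCast, ← Real.rpow_mul (by positivity)]
    norm_num
  simp only [hf, hg, hfg] at h
  rwa [show (1 : ℝ) / (3 / 2) = 2 / 3 by norm_num] at h

theorem Icount_two_le {p : ℕ} {X : ℝ} (hX : 0 ≤ X) (a b : ℕ) (ξ η : ℤ) :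
    (Icount p X 2 a b ξ η : ℝ) ≤
      (Icount p X 2 b a η ξ : ℝ) ^ ((1 : ℝ) / 3) *
        (Icount p X 1 a b ξ η : ℝ) ^ ((2 : ℝ) / 3) := by
  let N := 6 * ⌊X⌋₊ ^ 3 + 1
  have hN : 6 * ⌊X⌋₊ ^ 3 < N := Nat.lt_succ_self _
  let u (ψ : AddChar (Fin 3 → ZMod N) ℂ) : ℝ :=
    ‖∑ x ∈ residueClass ⌊X⌋₊ (p ^ a) ξ, ψ (momentCurve N x)‖ ^ 2
  let v (ψ : AddChar (Fin 3 → ZMod N) ℂ) : ℝ :=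
    ‖∑ x ∈ residueClass ⌊X⌋₊ (p ^ b) η, ψ (momentCurve N x)‖ ^ 2
  have h1 : ∑ ψ, u ψ ^ 2 * v ψ ^ 4 =
      (Fintype.card (Fin 3 → ZMod N) : ℝ) * Icount p X 2 a b ξ η := by
    rw [← sum_addChar_eq_mul_Icount hX hN]
    refine Finset.sum_congr rfl fun ψ _ ↦ ?_
    simp [Fin.prod_univ_six, u, v]
    ring
  have h2 : ∑ ψ, v ψ ^ 2 * u ψ ^ 4 =
      (Fintype.card (Fin 3 → ZMod N) : ℝ) * Icount p X 2 b a η ξ := by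
    rw [← sum_addChar_eq_mul_Icount hX hN]
    refine Finset.sum_congr rfl fun ψ _ ↦ ?_
    simp [Fin.prod_univ_six, u, v]
    ring
  have h3 : ∑ ψ, u ψ * v ψ ^ 5 =
      (Fintype.card (Fin 3 → ZMod N) : ℝ) * Icount p X 1 a b ξ η := by
    rw [← sum_addChar_eq_mul_Icount hX hN]
    refine Finset.sum_congr rfl fun ψ _ ↦ ?_
    simp [Fin.prod_univ_six, u, v]
    ring
  have holder := sum_pow_mul_pow_le_rpow_mul_rpow Finset.univ (u := u) (v := v)
    (fun _ ↦ by positivity) (fun _ ↦ by positivity)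
  have card_pos : (0 : ℝ) < Fintype.card (Fin 3 → ZMod N) := by
    exact_mod_cast Fintype.card_pos
  rw [h1, h2, h3, Real.mul_rpow card_pos.le (Nat.cast_nonneg _),
    Real.mul_rpow card_pos.le (Nat.cast_nonneg _), mul_mul_mul_comm,
    ← Real.rpow_add card_pos, show (1 : ℝ) / 3 + 2 / 3 = 1 by norm_num, Real.rpow_one] at holder
  exact le_of_mul_le_mul_left holder card_pos

theorem Icount_le {X : ℝ} (hX : 0 ≤ X) (p m a b : ℕ) (ξ η : ℤ) :
    Icount p X m a b ξ η ≤ ⌊X⌋₊ ^ 6 * ⌊X⌋₊ ^ 6 := by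
  rw [Icount_eq_card_filter hX (Nat.lt_succ_self _) m a b ξ η _ fun _ ↦ rfl]
  refine (Finset.card_filter_le _ _).trans ?_
  rw [Finset.card_product, Fintype.card_piFinset]
  have h : ∏ i : Fin 6, (if i.1 < m then residueClass ⌊X⌋₊ (p ^ a) ξ
      else residueClass ⌊X⌋₊ (p ^ b) η).card ≤ ⌊X⌋₊ ^ 6 := by
    refine (Finset.prod_le_pow_card _ _ ⌊X⌋₊ fun i _ ↦ ?_).trans (by simp)
    split_ifs <;> exact (Finset.card_filter_le _ _).trans (by simp)
  exact Nat.mul_le_mul h h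

theorem bddAbove_Icount {X : ℝ} (hX : 0 ≤ X) (p m a b : ℕ) :
    BddAbove {n : ℕ | ∃ ξ η : ℤ, ¬ ξ ≡ η [ZMOD (p : ℤ)] ∧ n = Icount p X m a b ξ η} := by
  refine ⟨⌊X⌋₊ ^ 6 * ⌊X⌋₊ ^ 6, ?_⟩
  rintro n ⟨ξ, η, -, rfl⟩
  exact Icount_le hX p m a b ξ η

theorem Icount_le_Imax {p : ℕ} {X : ℝ} (hX : 0 ≤ X) {m : ℕ} (hm : m ≠ 0) (a b : ℕ) {ξ η : ℤ}
    (h : ¬ ξ ≡ η [ZMOD (p : ℤ)]) : Icount p X m a b ξ η ≤ Imax p X m a b := by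
  rw [Imax, if_neg hm]
  exact le_csSup (bddAbove_Icount hX p m a b) ⟨ξ, η, h, rfl⟩

theorem exists_Imax_eq_Icount {p : ℕ} (hp : p ≠ 1) {X : ℝ} (hX : 0 ≤ X) {m : ℕ} (hm : m ≠ 0)
    (a b : ℕ) :
    ∃ ξ η : ℤ, ¬ ξ ≡ η [ZMOD (p : ℤ)] ∧ Imax p X m a b = Icount p X m a b ξ η := by
  rw [Imax, if_neg hm]
  have not_modEq : ¬ (0 : ℤ) ≡ 1 [ZMOD (p : ℤ)] := by
    rw [Int.modEq_iff_dvd, sub_zero]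
    exact fun h ↦ hp (by exact_mod_cast Int.eq_one_of_dvd_one (Int.natCast_nonneg p) h)
  have nonempty : {n : ℕ | ∃ ξ η : ℤ, ¬ ξ ≡ η [ZMOD (p : ℤ)] ∧
      n = Icount p X m a b ξ η}.Nonempty := ⟨_, 0, 1, not_modEq, rfl⟩
  exact Nat.sSup_mem nonempty (bddAbove_Icount hX p m a b)

/-- Lemma 3: `I₂(X;a,b) ≤ I₂(X;b,a)^(1/3) · I₁(X;a,b)^(2/3)`. -/
theorem I2_le_I2_I1 (p : ℕ) (hp : p.Prime) (hp5 : 5 ≤ p) (a b : ℕ) (ha : 1 ≤ a) (hb : 1 ≤ b)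
    (X : ℝ) (hX : 1 ≤ X) :
    (Imax p X 2 a b : ℝ) ≤
      (Imax p X 2 b a : ℝ) ^ ((1 : ℝ) / 3) * (Imax p X 1 a b : ℝ) ^ ((2 : ℝ) / 3) := by
  have hX' : 0 ≤ X := by linarith
  obtain ⟨ξ, η, h, hI⟩ := exists_Imax_eq_Icount hp.ne_one hX' two_ne_zero a b
  rw [hI]
  refine (Icount_two_le hX' a b ξ η).trans ?_
  have h2 := Icount_le_Imax hX' two_ne_zero b a fun h' ↦ h h'.symm
  have h1 := Icount_le_Imax hX' one_ne_zero a b h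
  gcongr
end

section
/- If 1 ≤ a ≤ b and p^b ≤ X then I_2(X;a,b) ≤ 2b · p^{−10a/3 + 14b/3} · I_2(X;b,2b−a)^{1/3} · I_2(X;b,3b)^{1/6} · J(2X/p^b)^{1/2}. -/
/-- `Jcount s k X` is the number of `2s`-tuples `(x₁,…,x_{2s})` of positive integers
with each `xᵢ ≤ X` satisfying `x₁ʲ+⋯+x_sʲ = x_{s+1}ʲ+⋯+x_{2s}ʲ` for all `1 ≤ j ≤ k`.
The tuple is encoded as a pair of `s`-tuples (the two sides of the system). -/
noncomputable def Jcount (s k : ℕ) (X : ℝ) : ℕ :=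
  Nat.card {xy : (Fin s → ℕ) × (Fin s → ℕ) //
    (∀ i, 1 ≤ xy.1 i ∧ (xy.1 i : ℝ) ≤ X) ∧
    (∀ i, 1 ≤ xy.2 i ∧ (xy.2 i : ℝ) ≤ X) ∧
    ∀ j ∈ Finset.Icc 1 k, ∑ i, xy.1 i ^ j = ∑ i, xy.2 i ^ j}

section Cubic

open Finset

/-- The number of solutions of the Vinogradov system of degree three in six pairs of variables,
the variables being restricted to the finite sets `s i` and `t i`. -/
def solCount (s t : Fin 6 → Finset ℕ) : ℕ :=
  #{xy ∈ Fintype.piFinset s ×ˢ Fintype.piFinset t |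
    ∀ j ∈ Icc 1 3, ∑ i, xy.1 i ^ j = ∑ i, xy.2 i ^ j}

/-- The integers of `[1, K]` congruent to `ξ` modulo `q`. -/
def resClass (K : ℕ) (q ξ : ℤ) : Finset ℕ := {x ∈ Icc 1 K | (x : ℤ) ≡ ξ [ZMOD q]}

/-- The point `(x, x², x³)` of `(ℤ/N)³`. -/
def momentPoint (N x : ℕ) : Fin 3 → ZMod N := fun j => (x : ZMod N) ^ ((j : ℕ) + 1)

/-- The cubic exponential sum over `S` attached to an additive character of `(ℤ/N)³`. -/
noncomputable def weylSum (N : ℕ) (S : Finset ℕ) (ψ : AddChar (Fin 3 → ZMod N) ℂ) : ℂ :=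
  ∑ x ∈ S, ψ (momentPoint N x)

lemma mem_resClass {K x : ℕ} {q ξ : ℤ} :
    x ∈ resClass K q ξ ↔ (1 ≤ x ∧ x ≤ K) ∧ (x : ℤ) ≡ ξ [ZMOD q] := by
  simp [resClass]

/-- The system of sets equal to `A` at the first `m` indices and to `B` at the others. -/
def splitSets (m : ℕ) (A B : Finset ℕ) : Fin 6 → Finset ℕ := fun i => if (i : ℕ) < m then A else B

lemma Icount_eq_solCount (p : ℕ) (X : ℝ) (m a b : ℕ) (ξ η : ℤ) :
    Icount p X m a b ξ η =
      solCount
        (splitSets m (resClass ⌊X⌋₊ ((p : ℤ) ^ a) ξ) (resClass ⌊X⌋₊ ((p : ℤ) ^ b) η))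
        (splitSets m (resClass ⌊X⌋₊ ((p : ℤ) ^ a) ξ) (resClass ⌊X⌋₊ ((p : ℤ) ^ b) η)) := by
  have key : ∀ x : Fin 6 → ℕ,
      (∀ i : Fin 6, x i ∈ (if (i : ℕ) < m then resClass ⌊X⌋₊ ((p : ℤ) ^ a) ξ
          else resClass ⌊X⌋₊ ((p : ℤ) ^ b) η)) ↔
      (∀ i, 1 ≤ x i ∧ (x i : ℝ) ≤ X) ∧
        ∀ i : Fin 6, if (i : ℕ) < m then (x i : ℤ) ≡ ξ [ZMOD (p : ℤ) ^ a]
          else (x i : ℤ) ≡ η [ZMOD (p : ℤ) ^ b] := by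
    intro x
    rw [← forall_and]
    refine forall_congr' fun i => ?_
    have h1 : (1 ≤ x i ∧ x i ≤ ⌊X⌋₊) ↔ (1 ≤ x i ∧ (x i : ℝ) ≤ X) :=
      and_congr_right fun h => Nat.le_floor_iff' (by omega)
    split_ifs <;> rw [mem_resClass, h1]
  rw [Icount, solCount, ← Nat.subtype_card]
  rintro ⟨x, y⟩
  simp only [mem_filter, mem_product, Fintype.mem_piFinset, splitSets, key]
  tauto

lemma sum_momentPoint_eq_iff {K N : ℕ} (hN : 6 * (K + 1) ^ 3 < N) {x y : Fin 6 → ℕ}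
    (hx : ∀ i, x i ≤ K) (hy : ∀ i, y i ≤ K) :
    ∑ i, momentPoint N (x i) = ∑ i, momentPoint N (y i) ↔
      ∀ j ∈ Icc 1 3, ∑ i, x i ^ j = ∑ i, y i ^ j := by
  have bound : ∀ {x : Fin 6 → ℕ}, (∀ i, x i ≤ K) → ∀ j : Fin 3,
      ∑ i, x i ^ ((j : ℕ) + 1) < N := by
    intro x hx j
    refine lt_of_le_of_lt ?_ hN
    calc ∑ i, x i ^ ((j : ℕ) + 1) ≤ ∑ _i : Fin 6, (K + 1) ^ 3 := by
          refine sum_le_sum fun i _ => ?_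
          calc x i ^ ((j : ℕ) + 1) ≤ (K + 1) ^ ((j : ℕ) + 1) :=
                Nat.pow_le_pow_left ((hx i).trans (Nat.le_succ K)) _
            _ ≤ (K + 1) ^ 3 := Nat.pow_le_pow_right (Nat.succ_pos K) (by omega)
      _ = 6 * (K + 1) ^ 3 := by simp
  have coord : ∀ j : Fin 3, (∑ i, momentPoint N (x i)) j = (∑ i, momentPoint N (y i)) j ↔
      ∑ i, x i ^ ((j : ℕ) + 1) = ∑ i, y i ^ ((j : ℕ) + 1) := by
    intro j
    simp only [Finset.sum_apply, momentPoint]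
    have := ZMod.natCast_eq_natCast_iff' (∑ i, x i ^ ((j : ℕ) + 1)) (∑ i, y i ^ ((j : ℕ) + 1)) N
    rw [Nat.mod_eq_of_lt (bound hx j), Nat.mod_eq_of_lt (bound hy j)] at this
    rw [← this]
    push_cast
    rfl
  rw [funext_iff]
  simp only [coord]
  constructor
  · intro h j hj
    rw [mem_Icc] at hj
    have := h ⟨j - 1, by omega⟩
    rwa [show j - 1 + 1 = j by omega] at this
  · intro h j
    exact h _ (by rw [mem_Icc]; omega)

lemma addChar_map_sum {A ι : Type*} [AddCommMonoid A] (ψ : AddChar A ℂ) (s : Finset ι) (f : ι → A) :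
    ψ (∑ i ∈ s, f i) = ∏ i ∈ s, ψ (f i) := by
  classical
  induction s using Finset.induction_on with
  | empty => simp
  | insert i s hi ih => rw [sum_insert hi, prod_insert hi, AddChar.map_add_eq_mul, ih]

lemma card_mul_solCount {K N : ℕ} [NeZero N] (hN : 6 * (K + 1) ^ 3 < N) {s t : Fin 6 → Finset ℕ}
    (hs : ∀ i, ∀ x ∈ s i, x ≤ K) (ht : ∀ i, ∀ x ∈ t i, x ≤ K) :
    (Fintype.card (Fin 3 → ZMod N) : ℂ) * solCount s t =
      ∑ ψ : AddChar (Fin 3 → ZMod N) ℂ,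
        (∏ i, weylSum N (s i) ψ) * ∏ i, (starRingEnd ℂ) (weylSum N (t i) ψ) := by
  classical
  have expand : ∀ ψ : AddChar (Fin 3 → ZMod N) ℂ,
      (∏ i, weylSum N (s i) ψ) * ∏ i, (starRingEnd ℂ) (weylSum N (t i) ψ) =
      ∑ xy ∈ Fintype.piFinset s ×ˢ Fintype.piFinset t,
        ψ (∑ i, momentPoint N (xy.1 i) - ∑ i, momentPoint N (xy.2 i)) := by
    intro ψ
    simp only [weylSum, map_sum]
    rw [prod_univ_sum, prod_univ_sum, sum_mul_sum, sum_product]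
    refine sum_congr rfl fun x _ => sum_congr rfl fun y _ => ?_
    rw [sub_eq_add_neg, AddChar.map_add_eq_mul, AddChar.map_neg_eq_conj,
      addChar_map_sum, addChar_map_sum, map_prod]
  simp only [expand]
  rw [sum_comm]
  simp only [AddChar.sum_apply_eq_ite, sub_eq_zero]
  rw [← sum_filter, sum_const, nsmul_eq_mul, mul_comm, solCount]
  congr 3
  refine filter_congr fun xy hxy => ?_
  rw [mem_product, Fintype.mem_piFinset, Fintype.mem_piFinset] at hxy
  exact (sum_momentPoint_eq_iff hN (fun i => hs i _ (hxy.1 i)) fun i => ht i _ (hxy.2 i)).symm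

lemma sum_rpow_mul_rpow_le {ι : Type*} (s : Finset ι) {u v : ι → ℝ} (hu : ∀ i, 0 ≤ u i)
    (hv : ∀ i, 0 ≤ v i) {θ τ : ℝ} (hθ : 0 < θ) (hτ : 0 < τ) (h : θ + τ = 1) :
    ∑ i ∈ s, u i ^ θ * v i ^ τ ≤ (∑ i ∈ s, u i) ^ θ * (∑ i ∈ s, v i) ^ τ := by
  have hc : Real.HolderConjugate θ⁻¹ τ⁻¹ :=
    Real.holderConjugate_iff.2 ⟨(one_lt_inv₀ hθ).2 (by linarith), by simpa using h⟩
  have := Real.inner_le_Lp_mul_Lq_of_nonneg s hc (f := fun i => u i ^ θ) (g := fun i => v i ^ τ)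
    (fun i _ => Real.rpow_nonneg (hu i) _) (fun i _ => Real.rpow_nonneg (hv i) _)
  simpa [← Real.rpow_mul (hu _), ← Real.rpow_mul (hv _), hθ.ne', hτ.ne'] using this

lemma forall_mem_splitSets_le {K m : ℕ} {A B : Finset ℕ} (hA : ∀ x ∈ A, x ≤ K)
    (hB : ∀ x ∈ B, x ≤ K) (i : Fin 6) (x : ℕ) (hx : x ∈ splitSets m A B i) : x ≤ K := by
  unfold splitSets at hx
  split_ifs at hx
  exacts [hA x hx, hB x hx]

lemma card_mul_solCount_splitSets {K N m : ℕ} [NeZero N] (hm : m ≤ 6) (hN : 6 * (K + 1) ^ 3 < N)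
    {A B : Finset ℕ} (hA : ∀ x ∈ A, x ≤ K) (hB : ∀ x ∈ B, x ≤ K) :
    (Fintype.card (Fin 3 → ZMod N) : ℝ) * solCount (splitSets m A B) (splitSets m A B) =
      ∑ ψ : AddChar (Fin 3 → ZMod N) ℂ,
        ‖weylSum N A ψ‖ ^ (2 * m) * ‖weylSum N B ψ‖ ^ (2 * (6 - m)) := by
  have h := card_mul_solCount hN (forall_mem_splitSets_le (m := m) hA hB)
    (forall_mem_splitSets_le (m := m) hA hB)
  have hprod : ∀ ψ : AddChar (Fin 3 → ZMod N) ℂ,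
      (∏ i, weylSum N (splitSets m A B i) ψ) *
        ∏ i, (starRingEnd ℂ) (weylSum N (splitSets m A B i) ψ) =
      ((‖weylSum N A ψ‖ ^ (2 * m) * ‖weylSum N B ψ‖ ^ (2 * (6 - m)) : ℝ) : ℂ) := by
    intro ψ
    rw [← prod_mul_distrib]
    simp only [Complex.mul_conj']
    push_cast
    rw [pow_mul, pow_mul]
    interval_cases m <;> simp [Fin.prod_univ_six, splitSets, -mul_eq_mul_left_iff, -mul_eq_mul_right_iff] <;> ring
  simp only [hprod] at h
  exact_mod_cast h

/-- Hölder's inequality for the numbers of solutions in which the variables are split between two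
sets. -/
lemma solCount_splitSets_le {k l m : ℕ} (hk : k ≤ 6) (hl : l ≤ 6) (hm : m ≤ 6) {θ τ : ℝ}
    (hθ : 0 < θ) (hτ : 0 < τ) (hθτ : θ + τ = 1) (hexp : (m : ℝ) = θ * (6 - k) + τ * l)
    (A B : Finset ℕ) :
    (solCount (splitSets m A B) (splitSets m A B) : ℝ) ≤
      (solCount (splitSets k B A) (splitSets k B A) : ℝ) ^ θ *
        (solCount (splitSets l A B) (splitSets l A B) : ℝ) ^ τ := by
  obtain ⟨K, hK⟩ := (A ∪ B).bddAbove
  have hA : ∀ x ∈ A, x ≤ K := fun x hx => hK (by simp [hx])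
  have hB : ∀ x ∈ B, x ≤ K := fun x hx => hK (by simp [hx])
  have hN : 6 * (K + 1) ^ 3 < 6 * (K + 1) ^ 3 + 1 := Nat.lt_succ_self _
  have hC : (0 : ℝ) < (Fintype.card (Fin 3 → ZMod (6 * (K + 1) ^ 3 + 1)) : ℝ) := by
    exact_mod_cast Fintype.card_pos
  refine le_of_mul_le_mul_left ?_ hC
  have hsplit : ∀ C x y : ℝ, 0 < C → 0 ≤ x → 0 ≤ y →
      C * (x ^ θ * y ^ τ) = (C * x) ^ θ * (C * y) ^ τ := by
    intro C x y hC hx hy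
    rw [Real.mul_rpow hC.le hx, Real.mul_rpow hC.le hy, mul_mul_mul_comm,
      ← Real.rpow_add hC, hθτ, Real.rpow_one]
  rw [hsplit _ _ _ hC (by positivity) (by positivity), card_mul_solCount_splitSets hm hN hA hB,
    card_mul_solCount_splitSets hk hN hB hA, card_mul_solCount_splitSets hl hN hA hB]
  refine le_trans (le_of_eq ?_) (sum_rpow_mul_rpow_le univ (fun ψ => by positivity)
    (fun ψ => by positivity) hθ hτ hθτ)
  refine sum_congr rfl fun ψ _ => ?_
  have hx := norm_nonneg (weylSum (6 * (K + 1) ^ 3 + 1) A ψ)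
  have hy := norm_nonneg (weylSum (6 * (K + 1) ^ 3 + 1) B ψ)
  generalize ‖weylSum (6 * (K + 1) ^ 3 + 1) A ψ‖ = x at hx
  generalize ‖weylSum (6 * (K + 1) ^ 3 + 1) B ψ‖ = y at hy
  have hk' : (k : ℝ) ≤ 6 := by exact_mod_cast hk
  have hl' : (l : ℝ) ≤ 6 := by exact_mod_cast hl
  rw [Real.mul_rpow (by positivity) (by positivity), Real.mul_rpow (by positivity) (by positivity)]
  simp only [← Real.rpow_natCast, ← Real.rpow_mul hx, ← Real.rpow_mul hy]
  push_cast [hk, hl, hm]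
  rw [mul_comm (y ^ _) (x ^ _), mul_mul_mul_comm,
    ← Real.rpow_add_of_nonneg hx (mul_nonneg (by linarith) hθ.le) (by positivity),
    ← Real.rpow_add_of_nonneg hy (by positivity) (mul_nonneg (by linarith) hτ.le)]
  congr 2
  · linear_combination 2 * hexp
  · linear_combination -2 * hexp - 12 * hθτ

/-- The arithmetic-geometric mean inequality for the number of solutions in which the first two
variables on each side range over different sets. -/
lemma solCount_mixed_le (A₁ A₂ A₃ A₄ B : Finset ℕ) {R : ℝ}
    (h₁ : solCount (splitSets 2 A₁ B) (splitSets 2 A₁ B) ≤ R)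
    (h₂ : solCount (splitSets 2 A₂ B) (splitSets 2 A₂ B) ≤ R)
    (h₃ : solCount (splitSets 2 A₃ B) (splitSets 2 A₃ B) ≤ R)
    (h₄ : solCount (splitSets 2 A₄ B) (splitSets 2 A₄ B) ≤ R) :
    solCount ![A₁, A₂, B, B, B, B] ![A₃, A₄, B, B, B, B] ≤ R := by
  obtain ⟨K, hK⟩ := (A₁ ∪ A₂ ∪ A₃ ∪ A₄ ∪ B).bddAbove
  have hA₁ : ∀ x ∈ A₁, x ≤ K := fun x hx => hK (by simp [hx])
  have hA₂ : ∀ x ∈ A₂, x ≤ K := fun x hx => hK (by simp [hx])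
  have hA₃ : ∀ x ∈ A₃, x ≤ K := fun x hx => hK (by simp [hx])
  have hA₄ : ∀ x ∈ A₄, x ≤ K := fun x hx => hK (by simp [hx])
  have hB : ∀ x ∈ B, x ≤ K := fun x hx => hK (by simp [hx])
  have hN : 6 * (K + 1) ^ 3 < 6 * (K + 1) ^ 3 + 1 := Nat.lt_succ_self _
  set N := 6 * (K + 1) ^ 3 + 1
  have hC : (0 : ℝ) < (Fintype.card (Fin 3 → ZMod N) : ℝ) := by
    exact_mod_cast Fintype.card_pos
  refine le_of_mul_le_mul_left ?_ hC
  have hmix := card_mul_solCount (s := ![A₁, A₂, B, B, B, B]) (t := ![A₃, A₄, B, B, B, B]) hN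
    (by simpa [Fin.forall_fin_succ] using ⟨hA₁, hA₂, hB⟩)
    (by simpa [Fin.forall_fin_succ] using ⟨hA₃, hA₄, hB⟩)
  have hle : (Fintype.card (Fin 3 → ZMod N) : ℝ) *
      solCount ![A₁, A₂, B, B, B, B] ![A₃, A₄, B, B, B, B] ≤
      ∑ ψ : AddChar (Fin 3 → ZMod N) ℂ,
        ‖(∏ i, weylSum N (![A₁, A₂, B, B, B, B] i) ψ) *
          ∏ i, (starRingEnd ℂ) (weylSum N (![A₃, A₄, B, B, B, B] i) ψ)‖ := by
    refine le_trans (le_of_eq ?_) (norm_sum_le _ _)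
    rw [← hmix]
    simp
  refine hle.trans ?_
  have hpt : ∀ ψ : AddChar (Fin 3 → ZMod N) ℂ,
      ‖(∏ i, weylSum N (![A₁, A₂, B, B, B, B] i) ψ) *
          ∏ i, (starRingEnd ℂ) (weylSum N (![A₃, A₄, B, B, B, B] i) ψ)‖ ≤
        1 / 4 * (‖weylSum N A₁ ψ‖ ^ (2 * 2) * ‖weylSum N B ψ‖ ^ (2 * (6 - 2))) +
        1 / 4 * (‖weylSum N A₂ ψ‖ ^ (2 * 2) * ‖weylSum N B ψ‖ ^ (2 * (6 - 2))) +
        1 / 4 * (‖weylSum N A₃ ψ‖ ^ (2 * 2) * ‖weylSum N B ψ‖ ^ (2 * (6 - 2))) +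
        1 / 4 * (‖weylSum N A₄ ψ‖ ^ (2 * 2) * ‖weylSum N B ψ‖ ^ (2 * (6 - 2))) := by
    intro ψ
    simp only [Fin.prod_univ_six, norm_mul, RCLike.norm_conj, Matrix.cons_val]
    have amgm : ∀ x y z w : ℝ,
        x * y * z * w ≤ 1 / 4 * (x ^ 4 + y ^ 4 + z ^ 4 + w ^ 4) := by
      intro x y z w
      nlinarith [sq_nonneg (x * y - z * w), sq_nonneg (x ^ 2 - y ^ 2), sq_nonneg (z ^ 2 - w ^ 2)]
    have := mul_le_mul_of_nonneg_right (amgm ‖weylSum N A₁ ψ‖ ‖weylSum N A₂ ψ‖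
      ‖weylSum N A₃ ψ‖ ‖weylSum N A₄ ψ‖) (show 0 ≤ ‖weylSum N B ψ‖ ^ 8 by positivity)
    norm_num
    linarith
  refine (sum_le_sum fun ψ _ => hpt ψ).trans ?_
  simp only [sum_add_distrib, ← mul_sum]
  rw [← card_mul_solCount_splitSets (by norm_num) hN hA₁ hB,
    ← card_mul_solCount_splitSets (by norm_num) hN hA₂ hB,
    ← card_mul_solCount_splitSets (by norm_num) hN hA₃ hB,
    ← card_mul_solCount_splitSets (by norm_num) hN hA₄ hB]
  nlinarith

lemma sum_sub_pow_eq {x y : Fin 6 → ℕ} (h : ∀ j ∈ Icc 1 3, ∑ i, x i ^ j = ∑ i, y i ^ j) (c : ℤ) :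
    ∀ j ∈ Icc 1 3, ∑ i, ((x i : ℤ) - c) ^ j = ∑ i, ((y i : ℤ) - c) ^ j := by
  have hz : ∀ j ∈ Icc 1 3, ∑ i, (x i : ℤ) ^ j = ∑ i, (y i : ℤ) ^ j := fun j hj => by
    exact_mod_cast h j hj
  have h1 := hz 1 (by decide)
  have h2 := hz 2 (by decide)
  have h3 := hz 3 (by decide)
  simp only [Fin.sum_univ_six] at h1 h2 h3 ⊢
  intro j hj
  rw [mem_Icc] at hj
  obtain ⟨hj1, hj3⟩ := hj
  interval_cases j
  · linear_combination h1
  · linear_combination h2 - 2 * c * h1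
  · linear_combination h3 - 3 * c * h2 + 3 * c ^ 2 * h1

lemma mem_solutions {s t : Fin 6 → Finset ℕ} {xy : (Fin 6 → ℕ) × (Fin 6 → ℕ)} :
    xy ∈ ({xy ∈ Fintype.piFinset s ×ˢ Fintype.piFinset t |
      ∀ j ∈ Icc 1 3, ∑ i, xy.1 i ^ j = ∑ i, xy.2 i ^ j} : Finset ((Fin 6 → ℕ) × (Fin 6 → ℕ))) ↔
    (∀ i, xy.1 i ∈ s i) ∧ (∀ i, xy.2 i ∈ t i) ∧
      ∀ j ∈ Icc 1 3, ∑ i, xy.1 i ^ j = ∑ i, xy.2 i ^ j := by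
  simp only [mem_filter, mem_product, Fintype.mem_piFinset, and_assoc]

lemma Jcount_eq_solCount (Y : ℝ) :
    Jcount 6 3 Y = solCount (fun _ => Icc 1 ⌊Y⌋₊) (fun _ => Icc 1 ⌊Y⌋₊) := by
  rw [Jcount, solCount, ← Nat.subtype_card]
  intro xy
  have key : ∀ n : ℕ, (1 ≤ n ∧ n ≤ ⌊Y⌋₊) ↔ (1 ≤ n ∧ (n : ℝ) ≤ Y) := fun n =>
    and_congr_right fun h => Nat.le_floor_iff' (by omega)
  simp only [mem_solutions, mem_Icc, key]

lemma solCount_resClass_le_Jcount {q : ℕ} (hq : 0 < q) {X : ℝ} (hqX : (q : ℝ) ≤ X) (η : ℤ) :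
    solCount (fun _ => resClass ⌊X⌋₊ q η) (fun _ => resClass ⌊X⌋₊ q η) ≤
      Jcount 6 3 (2 * X / q) := by
  have hqz : (0 : ℤ) < q := by exact_mod_cast hq
  have hqr : (0 : ℝ) < q := by exact_mod_cast hq
  obtain ⟨c, hc1, hc2, hc⟩ : ∃ c : ℤ, -(q : ℤ) ≤ c ∧ c < 0 ∧ c ≡ η [ZMOD q] :=
    ⟨η % q - q, by linarith [Int.emod_nonneg η hqz.ne'], by linarith [Int.emod_lt_of_pos η hqz],
      by simp [Int.ModEq]⟩
  have hrep : ∀ x ∈ resClass ⌊X⌋₊ q η, ∃ u ∈ Icc 1 ⌊2 * X / q⌋₊, (x : ℤ) = c + q * u := by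
    intro x hx
    obtain ⟨⟨hx1, hx2⟩, hx3⟩ := mem_resClass.1 hx
    have hxX : (x : ℝ) ≤ X := (Nat.le_floor_iff' (by omega)).1 hx2
    obtain ⟨w, hw⟩ := (hc.trans hx3.symm).dvd
    have hw0 : 0 < w := by
      by_contra! hneg
      nlinarith
    lift w to ℕ using hw0.le
    have hwr : (x : ℝ) - c = q * w := by exact_mod_cast hw
    have hcr : -(q : ℝ) ≤ c := by exact_mod_cast hc1
    refine ⟨w, mem_Icc.2 ⟨by omega, (Nat.le_floor_iff' (by omega)).2 ?_⟩, by linarith⟩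
    rw [le_div_iff₀ hqr]
    linarith
  choose! f hf hfx using hrep
  rw [Jcount_eq_solCount, solCount, solCount]
  refine card_le_card_of_injOn (fun xy => (fun i => f (xy.1 i), fun i => f (xy.2 i))) ?_ ?_
  · intro xy hxy
    obtain ⟨hx, hy, hsys⟩ := mem_solutions.1 (mem_coe.1 hxy)
    refine mem_coe.2 (mem_solutions.2 ⟨fun i => hf _ (hx i), fun i => hf _ (hy i), ?_⟩)
    intro j hj
    have := sum_sub_pow_eq hsys c j hj
    have hsub : ∀ x ∈ resClass ⌊X⌋₊ q η, (x : ℤ) - c = q * f x := fun x hx => by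
      rw [hfx x hx]; ring
    simp only [hsub _ (hx _), hsub _ (hy _), mul_pow, ← mul_sum] at this
    exact_mod_cast mul_left_cancel₀ (pow_ne_zero j hqz.ne') this
  · intro xy hxy xy' hxy' heq
    obtain ⟨hx, hy, -⟩ := mem_solutions.1 (mem_coe.1 hxy)
    obtain ⟨hx', hy', -⟩ := mem_solutions.1 (mem_coe.1 hxy')
    have hinj : ∀ x ∈ resClass ⌊X⌋₊ q η, ∀ x' ∈ resClass ⌊X⌋₊ q η, f x = f x' → x = x' := by
      intro x hx x' hx' h
      have h1 := hfx x hx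
      rw [h, ← hfx x' hx'] at h1
      exact_mod_cast h1
    rw [Prod.mk.injEq] at heq
    exact Prod.ext (funext fun i => hinj _ (hx i) _ (hx' i) (congrFun heq.1 i))
      (funext fun i => hinj _ (hy i) _ (hy' i) (congrFun heq.2 i))

lemma solCount_le_sum {ι : Type*} (T : Finset ι) {s t : Fin 6 → Finset ℕ}
    (s' t' : ι → Fin 6 → Finset ℕ)
    (h : ∀ x y : Fin 6 → ℕ, (∀ i, x i ∈ s i) → (∀ i, y i ∈ t i) →
      (∀ j ∈ Icc 1 3, ∑ i, x i ^ j = ∑ i, y i ^ j) →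
      ∃ k ∈ T, (∀ i, x i ∈ s' k i) ∧ ∀ i, y i ∈ t' k i) :
    solCount s t ≤ ∑ k ∈ T, solCount (s' k) (t' k) := by
  classical
  refine le_trans (card_le_card ?_) card_biUnion_le
  intro xy hxy
  obtain ⟨hx, hy, hsys⟩ := mem_solutions.1 hxy
  obtain ⟨k, hk, hx', hy'⟩ := h xy.1 xy.2 hx hy hsys
  exact mem_biUnion.2 ⟨k, hk, mem_solutions.2 ⟨hx', hy', hsys⟩⟩

lemma exists_residue_refinement {p a c : ℕ} (hp : 0 < p) (hac : a ≤ c) {x r : ℤ}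
    (h : x ≡ r [ZMOD (p : ℤ) ^ a]) :
    ∃ i ∈ range (p ^ (c - a)), x ≡ r + (p : ℤ) ^ a * i [ZMOD (p : ℤ) ^ c] := by
  obtain ⟨w, hw⟩ := h.symm.dvd
  have hpos : (0 : ℤ) < (p : ℤ) ^ (c - a) := by positivity
  refine ⟨(w % (p : ℤ) ^ (c - a)).toNat, ?_, ?_⟩
  · rw [mem_range]
    have := Int.emod_lt_of_pos w hpos
    zify
    rw [Int.toNat_of_nonneg (Int.emod_nonneg w hpos.ne')]
    exact this
  · rw [Int.toNat_of_nonneg (Int.emod_nonneg w hpos.ne')]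
    have h1 : w % (p : ℤ) ^ (c - a) ≡ w [ZMOD (p : ℤ) ^ (c - a)] := Int.mod_modEq _ _
    obtain ⟨v, hv⟩ := h1.dvd
    refine (Int.modEq_iff_dvd.2 ⟨v, ?_⟩).symm
    have : (p : ℤ) ^ c = (p : ℤ) ^ a * (p : ℤ) ^ (c - a) := by rw [← pow_add]; congr 1; omega
    rw [this]
    linear_combination hw + (p : ℤ) ^ a * hv

lemma isCoprime_pow_of_cast_ne_zero {p : ℕ} (hp : p.Prime) (n : ℕ) {w : ℤ}
    (hw : (w : ZMod p) ≠ 0) : IsCoprime ((p : ℤ) ^ n) w := by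
  refine IsCoprime.pow_left ?_
  rw [(Nat.prime_iff_prime_int.1 hp).irreducible.coprime_iff_not_dvd]
  rwa [ne_eq, ZMod.intCast_zmod_eq_zero_iff_dvd] at hw

lemma forall_mem_splitSets_one {A B : Finset ℕ} {x : Fin 6 → ℕ} :
    (∀ i, x i ∈ splitSets 1 A B i) ↔
      x 0 ∈ A ∧ x 1 ∈ B ∧ x 2 ∈ B ∧ x 3 ∈ B ∧ x 4 ∈ B ∧ x 5 ∈ B := by
  simp only [splitSets, Fin.forall_fin_succ]
  simp

lemma forall_mem_splitSets_two {A B : Finset ℕ} {x : Fin 6 → ℕ} :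
    (∀ i, x i ∈ splitSets 2 A B i) ↔
      x 0 ∈ A ∧ x 1 ∈ A ∧ x 2 ∈ B ∧ x 3 ∈ B ∧ x 4 ∈ B ∧ x 5 ∈ B := by
  simp only [splitSets, Fin.forall_fin_succ]
  simp

lemma forall_mem_vec {A A' B : Finset ℕ} {x : Fin 6 → ℕ} :
    (∀ i, x i ∈ (![A, A', B, B, B, B] : Fin 6 → Finset ℕ) i) ↔
      x 0 ∈ A ∧ x 1 ∈ A' ∧ x 2 ∈ B ∧ x 3 ∈ B ∧ x 4 ∈ B ∧ x 5 ∈ B := by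
  simp only [Fin.forall_fin_succ]
  simp

lemma cast_eq_of_modEq_pow {p n : ℕ} (hn : 1 ≤ n) {x r : ℤ} (h : x ≡ r [ZMOD (p : ℤ) ^ n]) :
    (x : ZMod p) = (r : ZMod p) :=
  (ZMod.intCast_eq_intCast_iff x r p).2 (h.of_dvd (dvd_pow_self _ (by omega)))

lemma natCast_ne_zero_of_lt {p n : ℕ} (hn : 0 < n) (hnp : n < p) : (n : ZMod p) ≠ 0 := by
  rw [ne_eq, ZMod.natCast_eq_zero_iff]
  exact Nat.not_dvd_of_pos_of_lt hn hnp

lemma pow_mul_dvd_sub_pow {p b j : ℕ} {x η : ℤ} (h : x ≡ η [ZMOD (p : ℤ) ^ b]) :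
    (p : ℤ) ^ (j * b) ∣ (x - η) ^ j := by
  rw [mul_comm, pow_mul]
  exact pow_dvd_pow_of_dvd h.symm.dvd j

lemma dvd_sub_of_add_eq_add {q A B C D : ℤ} (h : A + B = C + D) (hB : q ∣ B) (hD : q ∣ D) :
    q ∣ A - C := by
  rw [show A - C = D - B by linarith]
  exact dvd_sub hD hB

/-- A congruence satisfied by a single pair of variables modulo `p ^ a` lifts to modulus
`p ^ (3 * b)`. -/
lemma solCount_one_lift {p : ℕ} (hp : p.Prime) (hp5 : 5 ≤ p) {a b K : ℕ} (ha : 1 ≤ a)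
    (hab : a ≤ 3 * b) {ξ η : ℤ} (hξη : (ξ : ZMod p) ≠ η) {R : ℝ}
    (hR : ∀ ξ' : ℤ, (ξ' : ZMod p) = ξ →
      solCount (splitSets 1 (resClass K ((p : ℤ) ^ (3 * b)) ξ') (resClass K ((p : ℤ) ^ b) η))
        (splitSets 1 (resClass K ((p : ℤ) ^ (3 * b)) ξ') (resClass K ((p : ℤ) ^ b) η)) ≤ R) :
    solCount (splitSets 1 (resClass K ((p : ℤ) ^ a) ξ) (resClass K ((p : ℤ) ^ b) η))
        (splitSets 1 (resClass K ((p : ℤ) ^ a) ξ) (resClass K ((p : ℤ) ^ b) η)) ≤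
      (p : ℝ) ^ (3 * b - a) * R := by
  have := Fact.mk hp
  set B := resClass K ((p : ℤ) ^ b) η
  let A : ℕ → Finset ℕ := fun i => resClass K ((p : ℤ) ^ (3 * b)) (ξ + (p : ℤ) ^ a * i)
  have hsum := solCount_le_sum (range (p ^ (3 * b - a)))
    (s := splitSets 1 (resClass K ((p : ℤ) ^ a) ξ) B)
    (t := splitSets 1 (resClass K ((p : ℤ) ^ a) ξ) B)
    (fun i => splitSets 1 (A i) B) (fun i => splitSets 1 (A i) B) ?_
  · calc (solCount (splitSets 1 (resClass K ((p : ℤ) ^ a) ξ) B)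
          (splitSets 1 (resClass K ((p : ℤ) ^ a) ξ) B) : ℝ)
        ≤ ∑ i ∈ range (p ^ (3 * b - a)),
            (solCount (splitSets 1 (A i) B) (splitSets 1 (A i) B) : ℝ) := by exact_mod_cast hsum
      _ ≤ ∑ _i ∈ range (p ^ (3 * b - a)), R := by
          refine sum_le_sum fun i _ => hR _ ?_
          push_cast
          simp [show a ≠ 0 by omega]
      _ = (p : ℝ) ^ (3 * b - a) * R := by simp
  · intro x y hx hy hsys
    rw [forall_mem_splitSets_one] at hx hy
    obtain ⟨hx0, hx1, hx2, hx3, hx4, hx5⟩ := hx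
    obtain ⟨hy0, hy1, hy2, hy3, hy4, hy5⟩ := hy
    have cube : ∀ {n : ℕ}, n ∈ B → (p : ℤ) ^ (3 * b) ∣ ((n : ℤ) - η) ^ 3 := fun h =>
      pow_mul_dvd_sub_pow (mem_resClass.1 h).2
    have hdvd : (p : ℤ) ^ (3 * b) ∣ ((x 0 : ℤ) - η) ^ 3 - ((y 0 : ℤ) - η) ^ 3 := by
      have h3 := sum_sub_pow_eq hsys η 3 (by decide)
      simp only [Fin.sum_univ_six] at h3
      have hy' := dvd_add (dvd_add (dvd_add (dvd_add (cube hy1) (cube hy2)) (cube hy3))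
        (cube hy4)) (cube hy5)
      have hx' := dvd_add (dvd_add (dvd_add (dvd_add (cube hx1) (cube hx2)) (cube hx3))
        (cube hx4)) (cube hx5)
      exact dvd_sub_of_add_eq_add (by linear_combination h3) hx' hy'
    have hxp := cast_eq_of_modEq_pow ha (mem_resClass.1 hx0).2
    have hyp := cast_eq_of_modEq_pow ha (mem_resClass.1 hy0).2
    have hcop : IsCoprime ((p : ℤ) ^ (3 * b)) (((x 0 : ℤ) - η) ^ 2 +
        ((x 0 : ℤ) - η) * ((y 0 : ℤ) - η) + ((y 0 : ℤ) - η) ^ 2) := by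
      refine isCoprime_pow_of_cast_ne_zero hp _ ?_
      push_cast at hxp hyp ⊢
      rw [hxp, hyp]
      have h3 : (3 : ZMod p) ≠ 0 := by
        exact_mod_cast natCast_ne_zero_of_lt (p := p) (n := 3) (by norm_num) (by omega)
      have : ((ξ : ZMod p) - η) ^ 2 + ((ξ : ZMod p) - η) * (ξ - η) + (ξ - η) ^ 2 =
          3 * (ξ - η) ^ 2 := by ring
      rw [this]
      exact mul_ne_zero h3 (pow_ne_zero 2 (sub_ne_zero.2 hξη))
    have hxy : (p : ℤ) ^ (3 * b) ∣ (x 0 : ℤ) - y 0 := by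
      refine hcop.dvd_of_dvd_mul_right ?_
      rw [show ((x 0 : ℤ) - y 0) * (((x 0 : ℤ) - η) ^ 2 +
        ((x 0 : ℤ) - η) * ((y 0 : ℤ) - η) + ((y 0 : ℤ) - η) ^ 2) =
        ((x 0 : ℤ) - η) ^ 3 - ((y 0 : ℤ) - η) ^ 3 by ring]
      exact hdvd
    obtain ⟨i, hi, hi'⟩ := exists_residue_refinement hp.pos hab (mem_resClass.1 hy0).2
    refine ⟨i, hi, forall_mem_splitSets_one.2 ⟨mem_resClass.2 ⟨(mem_resClass.1 hx0).1, ?_⟩,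
      hx1, hx2, hx3, hx4, hx5⟩, forall_mem_splitSets_one.2
      ⟨mem_resClass.2 ⟨(mem_resClass.1 hy0).1, hi'⟩, hy1, hy2, hy3, hy4, hy5⟩⟩
    exact (Int.modEq_iff_dvd.2 hxy).symm.trans hi'

/-- A pair of congruences for two pairs of integers with a common unit residue modulo `p`. -/
lemma dvd_of_sum_sq_of_sum_cube {p : ℕ} (hp : p.Prime) (hp5 : 5 ≤ p) {n : ℕ} {y₁ y₂ y₃ y₄ : ℤ}
    {ν : ZMod p} (hν : ν ≠ 0) (h₁ : (y₁ : ZMod p) = ν) (h₂ : (y₂ : ZMod p) = ν)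
    (h₃ : (y₃ : ZMod p) = ν) (h₄ : (y₄ : ZMod p) = ν)
    (hsq : (p : ℤ) ^ n ∣ y₁ ^ 2 + y₂ ^ 2 - y₃ ^ 2 - y₄ ^ 2)
    (hcube : (p : ℤ) ^ n ∣ y₁ ^ 3 + y₂ ^ 3 - y₃ ^ 3 - y₄ ^ 3) :
    (p : ℤ) ^ n ∣ y₁ + y₂ - y₃ - y₄ ∧ (p : ℤ) ^ n ∣ (y₁ - y₄) * (y₂ - y₄) := by
  have := Fact.mk hp
  have two_ne : (2 : ZMod p) ≠ 0 := by
    exact_mod_cast natCast_ne_zero_of_lt (p := p) (n := 2) (by norm_num) (by omega)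
  have three_ne : (3 : ZMod p) ≠ 0 := by
    exact_mod_cast natCast_ne_zero_of_lt (p := p) (n := 3) (by norm_num) (by omega)
  set s := y₁ + y₃ with hs
  set t := y₂ + y₄ with ht
  set v := y₄ - y₂ with hv
  have hcop_s : IsCoprime ((p : ℤ) ^ n) s := by
    refine isCoprime_pow_of_cast_ne_zero hp _ ?_
    rw [hs]
    push_cast
    rw [h₁, h₃, ← two_mul]
    exact mul_ne_zero two_ne hν
  have hcop_two : IsCoprime ((p : ℤ) ^ n) 2 :=
    isCoprime_pow_of_cast_ne_zero hp _ (by exact_mod_cast two_ne)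
  have hcop : IsCoprime ((p : ℤ) ^ n) (3 * s ^ 3 * t - v ^ 2 * (s ^ 2 + s * t + t ^ 2)) := by
    refine isCoprime_pow_of_cast_ne_zero hp _ ?_
    rw [hs, ht, hv]
    push_cast
    rw [h₁, h₂, h₃, h₄]
    have : 3 * (ν + ν) ^ 3 * (ν + ν) -
        (ν - ν) ^ 2 * ((ν + ν) ^ 2 + (ν + ν) * (ν + ν) + (ν + ν) ^ 2) = 3 * 2 ^ 4 * ν ^ 4 := by
      ring
    rw [this]
    exact mul_ne_zero (mul_ne_zero three_ne (pow_ne_zero 4 two_ne)) (pow_ne_zero 4 hν)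
  have hvst : (p : ℤ) ^ n ∣ v * (s - t) := by
    refine hcop.dvd_of_dvd_mul_right ?_
    obtain ⟨k, hk⟩ := hsq
    obtain ⟨l, hl⟩ := hcube
    refine ⟨s ^ 3 * 4 * l - s ^ 2 * (3 * s ^ 2 + (y₁ - y₃) ^ 2) * k
      - v * t * (s * (y₁ - y₃) + t * v) * k, ?_⟩
    rw [hs, ht, hv]
    linear_combination
      (4 * (y₁ + y₃) ^ 3) * hl
      - ((y₁ + y₃) ^ 2 * (3 * (y₁ + y₃) ^ 2 + (y₁ - y₃) ^ 2)
        + (y₄ - y₂) * (y₂ + y₄) * ((y₁ + y₃) * (y₁ - y₃) + (y₂ + y₄) * (y₄ - y₂))) * hk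
  have hlin : (p : ℤ) ^ n ∣ y₁ + y₂ - y₃ - y₄ := by
    refine hcop_s.dvd_of_dvd_mul_left ?_
    convert dvd_sub hsq hvst using 1
    rw [hs, ht, hv]
    ring
  refine ⟨hlin, hcop_two.dvd_of_dvd_mul_left ?_⟩
  have : 2 * ((y₁ - y₄) * (y₂ - y₄)) = -(v * (s - t)) - v * (y₁ + y₂ - y₃ - y₄) := by
    rw [hs, ht, hv]
    ring
  rw [this]
  exact dvd_sub ((dvd_neg).2 hvst) (hlin.mul_left v)

lemma exists_pow_dvd_of_pow_dvd_mul {p : ℕ} (hp : p.Prime) {a b : ℕ} (hab : a ≤ b) {m n : ℤ}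
    (hm : (p : ℤ) ^ a ∣ m) (hn : (p : ℤ) ^ a ∣ n) (h : (p : ℤ) ^ (2 * b) ∣ m * n) :
    ∃ e ∈ Icc a (2 * b - a), (p : ℤ) ^ e ∣ m ∧ (p : ℤ) ^ (2 * b - e) ∣ n := by
  have hpz := Nat.prime_iff_prime_int.1 hp
  obtain ⟨c, d, hc, hd, hcd⟩ := exists_dvd_and_dvd_of_dvd_mul h
  obtain ⟨i, hi, hic⟩ := (dvd_prime_pow hpz _).1 ⟨d, hcd⟩
  have hdi : Associated d ((p : ℤ) ^ (2 * b - i)) := by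
    have hne : c ≠ 0 := fun h0 => pow_ne_zero (2 * b) hpz.ne_zero (by rw [hcd, h0, zero_mul])
    refine Associated.of_mul_left ?_ hic hne
    rw [← hcd, ← pow_add, Nat.add_sub_cancel' hi]
    exact Associated.refl _
  have hm' : (p : ℤ) ^ i ∣ m := hic.dvd_iff_dvd_left.1 hc
  have hn' : (p : ℤ) ^ (2 * b - i) ∣ n := hdi.dvd_iff_dvd_left.1 hd
  rcases lt_or_ge i a with h1 | h1
  · exact ⟨a, by rw [mem_Icc]; omega, hm, (pow_dvd_pow _ (by omega)).trans hn'⟩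
  rcases lt_or_ge (2 * b - a) i with h2 | h2
  · refine ⟨2 * b - a, by rw [mem_Icc]; omega, (pow_dvd_pow _ (by omega)).trans hm', ?_⟩
    rwa [show 2 * b - (2 * b - a) = a by omega]
  · exact ⟨i, mem_Icc.2 ⟨h1, h2⟩, hm', hn'⟩

/-- The congruences satisfied by two pairs of variables modulo `p ^ a` lift, up to a small number
of choices, to modulus `p ^ (2 * b - a)`. -/
lemma solCount_two_lift {p : ℕ} (hp : p.Prime) (hp5 : 5 ≤ p) {a b K : ℕ} (ha : 1 ≤ a)
    (hab : a ≤ b) {ξ η : ℤ} (hξη : (ξ : ZMod p) ≠ η) {R : ℝ} (hR0 : 0 ≤ R)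
    (hR : ∀ ξ' : ℤ, (ξ' : ZMod p) = ξ →
      solCount
        (splitSets 2 (resClass K ((p : ℤ) ^ (2 * b - a)) ξ') (resClass K ((p : ℤ) ^ b) η))
        (splitSets 2 (resClass K ((p : ℤ) ^ (2 * b - a)) ξ') (resClass K ((p : ℤ) ^ b) η)) ≤ R) :
    solCount (splitSets 2 (resClass K ((p : ℤ) ^ a) ξ) (resClass K ((p : ℤ) ^ b) η))
        (splitSets 2 (resClass K ((p : ℤ) ^ a) ξ) (resClass K ((p : ℤ) ^ b) η)) ≤
      2 * b * (p : ℝ) ^ (4 * (b - a)) * R := by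
  have := Fact.mk hp
  set B := resClass K ((p : ℤ) ^ b) η
  let A : ℤ → Finset ℕ := fun ξ' => resClass K ((p : ℤ) ^ (2 * b - a)) ξ'
  let T : Finset (Σ _ : ℕ, ℕ × ℕ × ℕ) := (Icc a (2 * b - a)).sigma fun e =>
    range (p ^ (2 * b - a - a)) ×ˢ range (p ^ (2 * b - a - e)) ×ˢ
      range (p ^ (2 * b - a - (2 * b - e)))
  let r₄ : (Σ _ : ℕ, ℕ × ℕ × ℕ) → ℤ := fun k => ξ + (p : ℤ) ^ a * k.2.1
  let r₁ : (Σ _ : ℕ, ℕ × ℕ × ℕ) → ℤ := fun k => r₄ k + (p : ℤ) ^ k.1 * k.2.2.1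
  let r₂ : (Σ _ : ℕ, ℕ × ℕ × ℕ) → ℤ := fun k => r₄ k + (p : ℤ) ^ (2 * b - k.1) * k.2.2.2
  let r₃ : (Σ _ : ℕ, ℕ × ℕ × ℕ) → ℤ := fun k => r₁ k + r₂ k - r₄ k
  have hT : (T.card : ℝ) ≤ 2 * b * (p : ℝ) ^ (4 * (b - a)) := by
    have h1 : T.card = (2 * b - a + 1 - a) * p ^ (4 * (b - a)) := by
      rw [card_sigma, sum_const_nat (m := p ^ (4 * (b - a))), Nat.card_Icc]
      intro e he
      rw [mem_Icc] at he
      simp only [card_product, card_range, ← pow_add]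
      congr 1
      omega
    rw [h1]
    push_cast
    gcongr
    have : 2 * b - a + 1 - a ≤ 2 * b := by omega
    exact_mod_cast this
  have hsum := solCount_le_sum T (s := splitSets 2 (resClass K ((p : ℤ) ^ a) ξ) B)
    (t := splitSets 2 (resClass K ((p : ℤ) ^ a) ξ) B)
    (fun k => ![A (r₁ k), A (r₂ k), B, B, B, B]) (fun k => ![A (r₃ k), A (r₄ k), B, B, B, B]) ?_
  · calc (solCount (splitSets 2 (resClass K ((p : ℤ) ^ a) ξ) B)
          (splitSets 2 (resClass K ((p : ℤ) ^ a) ξ) B) : ℝ)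
        ≤ ∑ k ∈ T, (solCount ![A (r₁ k), A (r₂ k), B, B, B, B]
            ![A (r₃ k), A (r₄ k), B, B, B, B] : ℝ) := by exact_mod_cast hsum
      _ ≤ ∑ _k ∈ T, R := by
          refine sum_le_sum fun k hk => ?_
          have hk1 := (mem_sigma.1 hk).1
          rw [mem_Icc] at hk1
          have h₄ : ((r₄ k : ℤ) : ZMod p) = ξ := by
            simp [r₄, show a ≠ 0 by omega]
          have h₁ : ((r₁ k : ℤ) : ZMod p) = ξ := by
            simp only [r₁]
            push_cast
            rw [h₄]
            simp [show k.1 ≠ 0 by omega]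
          have h₂ : ((r₂ k : ℤ) : ZMod p) = ξ := by
            simp only [r₂]
            push_cast
            rw [h₄]
            simp [show 2 * b - k.1 ≠ 0 by omega]
          have h₃ : ((r₃ k : ℤ) : ZMod p) = ξ := by
            simp only [r₃]
            push_cast
            rw [h₁, h₂, h₄]
            ring
          exact solCount_mixed_le _ _ _ _ _ (hR _ h₁) (hR _ h₂) (hR _ h₃) (hR _ h₄)
      _ = T.card * R := by simp
      _ ≤ 2 * b * (p : ℝ) ^ (4 * (b - a)) * R := mul_le_mul_of_nonneg_right hT hR0
  · intro x y hx hy hsys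
    rw [forall_mem_splitSets_two] at hx hy
    obtain ⟨hx0, hx1, hx2, hx3, hx4, hx5⟩ := hx
    obtain ⟨hy0, hy1, hy2, hy3, hy4, hy5⟩ := hy
    have hdvd : ∀ j ∈ Icc 1 3, 2 ≤ j → (p : ℤ) ^ (2 * b) ∣ ((x 0 : ℤ) - η) ^ j +
        ((x 1 : ℤ) - η) ^ j - (((y 0 : ℤ) - η) ^ j + ((y 1 : ℤ) - η) ^ j) := by
      intro j hj hj2
      have hpow : ∀ {n : ℕ}, n ∈ B → (p : ℤ) ^ (2 * b) ∣ ((n : ℤ) - η) ^ j := fun h =>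
        (pow_dvd_pow _ (Nat.mul_le_mul_right b hj2)).trans
          (pow_mul_dvd_sub_pow (mem_resClass.1 h).2)
      have hsum := sum_sub_pow_eq hsys η j hj
      simp only [Fin.sum_univ_six] at hsum
      exact dvd_sub_of_add_eq_add (by linear_combination hsum)
        (dvd_add (dvd_add (dvd_add (hpow hx2) (hpow hx3)) (hpow hx4)) (hpow hx5))
        (dvd_add (dvd_add (dvd_add (hpow hy2) (hpow hy3)) (hpow hy4)) (hpow hy5))
    have hcast : ∀ {n : ℕ}, n ∈ resClass K ((p : ℤ) ^ a) ξ →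
        (((n : ℤ) - η : ℤ) : ZMod p) = ξ - η := fun h => by
      rw [Int.cast_sub, cast_eq_of_modEq_pow ha (mem_resClass.1 h).2]
    obtain ⟨hlin, hmul⟩ := dvd_of_sum_sq_of_sum_cube hp hp5 (n := 2 * b) (sub_ne_zero.2 hξη)
      (hcast hx0) (hcast hx1) (hcast hy0) (hcast hy1)
      (by simpa only [sub_sub] using hdvd 2 (by decide) le_rfl)
      (by simpa only [sub_sub] using hdvd 3 (by decide) (by norm_num))
    rw [sub_sub_sub_cancel_right, sub_sub_sub_cancel_right] at hmul
    have hdiff : ∀ {n : ℕ}, n ∈ resClass K ((p : ℤ) ^ a) ξ → (p : ℤ) ^ a ∣ (n : ℤ) - y 1 :=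
      fun h => ((mem_resClass.1 hy1).2.trans (mem_resClass.1 h).2.symm).dvd
    obtain ⟨e, he, he0, he1⟩ := exists_pow_dvd_of_pow_dvd_mul hp hab (hdiff hx0) (hdiff hx1) hmul
    have he' := mem_Icc.1 he
    obtain ⟨i, hi, hi'⟩ := exists_residue_refinement (c := 2 * b - a) hp.pos (by omega)
      (mem_resClass.1 hy1).2
    obtain ⟨j, hj, hj'⟩ := exists_residue_refinement (c := 2 * b - a) hp.pos he'.2
      ((Int.modEq_iff_dvd.2 he0).symm.trans (hi'.of_dvd (pow_dvd_pow _ he'.2)))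
    obtain ⟨l, hl, hl'⟩ := exists_residue_refinement (a := 2 * b - e) (c := 2 * b - a) hp.pos
      (by omega) ((Int.modEq_iff_dvd.2 he1).symm.trans (hi'.of_dvd (pow_dvd_pow _ (by omega))))
    have hy0' : (y 0 : ℤ) ≡ x 0 + x 1 - y 1 [ZMOD (p : ℤ) ^ (2 * b - a)] := by
      refine Int.modEq_iff_dvd.2 ((pow_dvd_pow (p : ℤ) (show 2 * b - a ≤ 2 * b by omega)).trans ?_)
      rwa [show (x 0 : ℤ) + x 1 - y 1 - y 0 =
        (x 0 : ℤ) - η + (x 1 - η) - (y 0 - η) - (y 1 - η) by ring]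
    refine ⟨⟨e, i, j, l⟩, mem_sigma.2 ⟨he, mem_product.2 ⟨hi, mem_product.2 ⟨hj, hl⟩⟩⟩,
      forall_mem_vec.2 ⟨mem_resClass.2 ⟨(mem_resClass.1 hx0).1, hj'⟩,
        mem_resClass.2 ⟨(mem_resClass.1 hx1).1, hl'⟩, hx2, hx3, hx4, hx5⟩,
      forall_mem_vec.2 ⟨mem_resClass.2 ⟨(mem_resClass.1 hy0).1, ?_⟩,
        mem_resClass.2 ⟨(mem_resClass.1 hy1).1, hi'⟩, hy2, hy3, hy4, hy5⟩⟩
    exact hy0'.trans ((hj'.add hl').sub hi')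

lemma bddAbove_Icount_two (p : ℕ) (X : ℝ) (a b : ℕ) :
    BddAbove {n : ℕ | ∃ ξ η : ℤ, ¬ ξ ≡ η [ZMOD (p : ℤ)] ∧ n = Icount p X 2 a b ξ η} := by
  refine ⟨solCount (fun _ => Icc 1 ⌊X⌋₊) (fun _ => Icc 1 ⌊X⌋₊), ?_⟩
  rintro n ⟨ξ', η', -, rfl⟩
  have hsub : ∀ i, ∀ n ∈ splitSets 2 (resClass ⌊X⌋₊ ((p : ℤ) ^ a) ξ')
      (resClass ⌊X⌋₊ ((p : ℤ) ^ b) η') i, n ∈ Icc 1 ⌊X⌋₊ := by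
    intro i n hn
    unfold splitSets at hn
    split_ifs at hn <;> exact mem_Icc.2 (mem_resClass.1 hn).1
  rw [Icount_eq_solCount]
  have := solCount_le_sum ({()} : Finset Unit)
    (s := splitSets 2 (resClass ⌊X⌋₊ ((p : ℤ) ^ a) ξ') (resClass ⌊X⌋₊ ((p : ℤ) ^ b) η'))
    (t := splitSets 2 (resClass ⌊X⌋₊ ((p : ℤ) ^ a) ξ') (resClass ⌊X⌋₊ ((p : ℤ) ^ b) η'))
    (fun _ _ => Icc 1 ⌊X⌋₊) (fun _ _ => Icc 1 ⌊X⌋₊)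
    fun x y hx hy _ => ⟨(), mem_singleton_self _, fun i => hsub i _ (hx i), fun i => hsub i _ (hy i)⟩
  simpa using this

lemma Icount_le_Imax_two (p : ℕ) (X : ℝ) (a b : ℕ) {ξ η : ℤ} (h : (ξ : ZMod p) ≠ η) :
    Icount p X 2 a b ξ η ≤ Imax p X 2 a b := by
  rw [Imax, if_neg (by norm_num)]
  exact le_csSup (bddAbove_Icount_two p X a b)
    ⟨ξ, η, fun h' => h ((ZMod.intCast_eq_intCast_iff ξ η p).2 h'), rfl⟩

lemma Imax_two_mem {p : ℕ} (hp : p.Prime) (X : ℝ) (a b : ℕ) :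
    ∃ ξ η : ℤ, (ξ : ZMod p) ≠ η ∧ Imax p X 2 a b = Icount p X 2 a b ξ η := by
  have := Fact.mk hp
  have hne : ∀ {ξ η : ℤ}, ¬ ξ ≡ η [ZMOD (p : ℤ)] ↔ (ξ : ZMod p) ≠ η := fun {ξ η} =>
    not_congr (ZMod.intCast_eq_intCast_iff ξ η p).symm
  rw [Imax, if_neg (by norm_num)]
  obtain ⟨ξ, η, h, hmax⟩ := Nat.sSup_mem
    (s := {n : ℕ | ∃ ξ η : ℤ, ¬ ξ ≡ η [ZMOD (p : ℤ)] ∧ n = Icount p X 2 a b ξ η})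
    ⟨_, 1, 0, hne.2 (by simp), rfl⟩ (bddAbove_Icount_two p X a b)
  exact ⟨ξ, η, hne.1 h, hmax⟩

end Cubic

/-- Lemma 7 (the recursive estimate): if `1 ≤ a ≤ b` and `p^b ≤ X` then
`I₂(X;a,b) ≤ 2b · p^(−10a/3+14b/3) · I₂(X;b,2b−a)^(1/3) · I₂(X;b,3b)^(1/6) · J(2X/p^b)^(1/2)`. -/
theorem I2_recursive (p : ℕ) (hp : p.Prime) (hp5 : 5 ≤ p) (a b : ℕ) (ha : 1 ≤ a)
    (hab : a ≤ b) (X : ℝ) (hX : 1 ≤ X) (hpb : (p : ℝ) ^ b ≤ X) :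
    (Imax p X 2 a b : ℝ) ≤
      2 * b * (p : ℝ) ^ (-10 * (a : ℝ) / 3 + 14 * (b : ℝ) / 3) *
        (Imax p X 2 b (2 * b - a) : ℝ) ^ ((1 : ℝ) / 3) *
        (Imax p X 2 b (3 * b) : ℝ) ^ ((1 : ℝ) / 6) *
        (Jcount 6 3 (2 * X / (p : ℝ) ^ b) : ℝ) ^ ((1 : ℝ) / 2) := by
  have hone : ∀ ξ η : ℤ, (ξ : ZMod p) ≠ η →
      (Icount p X 1 (2 * b - a) b ξ η : ℝ) ≤ (p : ℝ) ^ (a + b) *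
        ((Imax p X 2 b (3 * b) : ℝ) ^ ((1 : ℝ) / 4) *
          (Jcount 6 3 (2 * X / (p : ℝ) ^ b) : ℝ) ^ ((3 : ℝ) / 4)) := by
    intro ξ η h
    have hlift := solCount_one_lift hp hp5 (K := ⌊X⌋₊) (a := 2 * b - a) (b := b) (by omega)
      (by omega) h (R := (Imax p X 2 b (3 * b) : ℝ) ^ ((1 : ℝ) / 4) *
          (Jcount 6 3 (2 * X / (p : ℝ) ^ b) : ℝ) ^ ((3 : ℝ) / 4)) ?_
    · rw [← Icount_eq_solCount, show 3 * b - (2 * b - a) = a + b by omega] at hlift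
      exact hlift
    · intro ξ' hξ'
      have hne : (η : ZMod p) ≠ ξ' := by rw [hξ']; exact h.symm
      refine (solCount_splitSets_le (k := 2) (l := 0) (m := 1) (by norm_num) (by norm_num)
        (by norm_num) (θ := 1 / 4) (τ := 3 / 4) (by norm_num) (by norm_num) (by norm_num)
        (by norm_num) _ _).trans ?_
      rw [← Icount_eq_solCount]
      have hJ := solCount_resClass_le_Jcount (q := p ^ b) (pow_pos hp.pos b)
        (X := X) (by exact_mod_cast hpb) η
      push_cast at hJ
      gcongr
      · exact Icount_le_Imax_two p X b (3 * b) hne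
      · exact hJ
  have htwo : ∀ ξ η : ℤ, (ξ : ZMod p) ≠ η →
      (Icount p X 2 (2 * b - a) b ξ η : ℝ) ≤
        (Imax p X 2 b (2 * b - a) : ℝ) ^ ((1 : ℝ) / 3) *
          ((p : ℝ) ^ (a + b) * ((Imax p X 2 b (3 * b) : ℝ) ^ ((1 : ℝ) / 4) *
            (Jcount 6 3 (2 * X / (p : ℝ) ^ b) : ℝ) ^ ((3 : ℝ) / 4))) ^ ((2 : ℝ) / 3) := by
    intro ξ η h
    rw [Icount_eq_solCount]
    refine (solCount_splitSets_le (k := 2) (l := 1) (m := 2) (by norm_num) (by norm_num)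
      (by norm_num) (θ := 1 / 3) (τ := 2 / 3) (by norm_num) (by norm_num) (by norm_num)
      (by norm_num) _ _).trans ?_
    rw [← Icount_eq_solCount, ← Icount_eq_solCount]
    gcongr
    · exact Icount_le_Imax_two p X b (2 * b - a) h.symm
    · exact hone ξ η h
  have hmax : (Imax p X 2 a b : ℝ) ≤ 2 * b * (p : ℝ) ^ (4 * (b - a)) *
      ((Imax p X 2 b (2 * b - a) : ℝ) ^ ((1 : ℝ) / 3) *
          ((p : ℝ) ^ (a + b) * ((Imax p X 2 b (3 * b) : ℝ) ^ ((1 : ℝ) / 4) *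
            (Jcount 6 3 (2 * X / (p : ℝ) ^ b) : ℝ) ^ ((3 : ℝ) / 4))) ^ ((2 : ℝ) / 3)) := by
    obtain ⟨ξ, η, hξη, hmem⟩ := Imax_two_mem hp X a b
    rw [hmem, Icount_eq_solCount]
    refine solCount_two_lift hp hp5 ha hab hξη (by positivity) fun ξ' hξ' => ?_
    rw [← Icount_eq_solCount]
    exact htwo ξ' η (by rw [hξ']; exact hξη)
  refine hmax.trans (le_of_eq ?_)
  have hp0 : (0 : ℝ) < p := by exact_mod_cast hp.pos
  generalize (Imax p X 2 b (2 * b - a) : ℝ) = U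
  have hV : (0 : ℝ) ≤ Imax p X 2 b (3 * b) := Nat.cast_nonneg _
  generalize (Imax p X 2 b (3 * b) : ℝ) = V at hV
  have hW : (0 : ℝ) ≤ Jcount 6 3 (2 * X / (p : ℝ) ^ b) := Nat.cast_nonneg _
  generalize (Jcount 6 3 (2 * X / (p : ℝ) ^ b) : ℝ) = W at hW
  rw [Real.mul_rpow (by positivity) (by positivity), Real.mul_rpow (by positivity) (by positivity),
    ← Real.rpow_mul hV, ← Real.rpow_mul hW, ← Real.rpow_natCast, ← Real.rpow_natCast,
    ← Real.rpow_mul hp0.le,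
    show -10 * (a : ℝ) / 3 + 14 * (b : ℝ) / 3 =
      ((4 * (b - a) : ℕ) : ℝ) + ((a + b : ℕ) : ℝ) * (2 / 3) by push_cast [hab]; ring,
    Real.rpow_add hp0, show (1 : ℝ) / 4 * (2 / 3) = 1 / 6 by norm_num,
    show (3 : ℝ) / 4 * (2 / 3) = 1 / 2 by norm_num]
  ring
end

section
/- For every integer a ≥ 1 and every integer c ≥ 0 one has N(p;a,c) ≤ (c+1) · p^{2c}. -/
/-- `Ncount p ν a c` is the number of quadruples `(y₁,y₂,y₇,y₈)` of residues modulo `p^c`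
satisfying `2ν S₁ + pᵃ S₂ ≡ 0` and `3ν S₂ + 2pᵃ S₃ ≡ 0 (mod p^c)`, where
`S_j = y₁ʲ + y₂ʲ − y₇ʲ − y₈ʲ`. -/
noncomputable def Ncount (p : ℕ) (ν : ℤ) (a c : ℕ) : ℕ :=
  Nat.card {y : ZMod (p ^ c) × ZMod (p ^ c) × ZMod (p ^ c) × ZMod (p ^ c) //
    2 * (ν : ZMod (p ^ c)) * (y.1 + y.2.1 - y.2.2.1 - y.2.2.2)
        + (p : ZMod (p ^ c)) ^ a * (y.1 ^ 2 + y.2.1 ^ 2 - y.2.2.1 ^ 2 - y.2.2.2 ^ 2) = 0 ∧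
    3 * (ν : ZMod (p ^ c)) * (y.1 ^ 2 + y.2.1 ^ 2 - y.2.2.1 ^ 2 - y.2.2.2 ^ 2)
        + 2 * (p : ZMod (p ^ c)) ^ a * (y.1 ^ 3 + y.2.1 ^ 3 - y.2.2.1 ^ 3 - y.2.2.2 ^ 3) = 0}

/-- A unit plus a multiple of a nilpotent element is a unit. -/
theorem isUnit_of_eq_add_nilpotent_mul {R : Type*} [CommRing R] {x n q m : R} (hn : IsUnit n)
    (hq : IsNilpotent q) (h : x = n + q * m) : IsUnit x := by
  subst h
  exact ((Commute.all q m).isNilpotent_mul_right hq).isUnit_add_left_of_commute hn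
    (Commute.all _ _)

/-- The pair of equations `2ν S₁ + q S₂ = 0` and `3ν S₂ + 2q S₃ = 0` with `q` nilpotent forces
`(y₁ - y₇) (y₁ - y₈) = 0`, as in the quadratic system `S₁ = S₂ = 0`. -/
theorem sub_mul_sub_eq_zero_of_system {R : Type*} [CommRing R] {ν q s v t u : R}
    (hν : IsUnit ν) (h6 : IsUnit (6 : R)) (hq : IsNilpotent q)
    (h₁ : 2 * ν * (s + v - t - u) + q * (s ^ 2 + v ^ 2 - t ^ 2 - u ^ 2) = 0)
    (h₂ : 3 * ν * (s ^ 2 + v ^ 2 - t ^ 2 - u ^ 2)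
      + 2 * q * (s ^ 3 + v ^ 3 - t ^ 3 - u ^ 3) = 0) :
    (s - t) * (s - u) = 0 := by
  obtain ⟨P, hP⟩ : ∃ P, P = 3 * ν * (u + v) + 2 * q * (u ^ 2 + u * v + v ^ 2) := ⟨_, rfl⟩
  obtain ⟨Q, hQ⟩ : ∃ Q, Q = 2 * ν + q * (u + v) := ⟨_, rfl⟩
  obtain ⟨X, hX⟩ : ∃ X, X = (3 * ν + 2 * q * (s + u + t)) * Q - q * P := ⟨_, rfl⟩
  obtain ⟨Y, hY⟩ : ∃ Y, Y = (3 * ν + 2 * q * (t + v + u)) * Q - q * P := ⟨_, rfl⟩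
  obtain ⟨B, hB⟩ : ∃ B, B = 2 * ν + q * (s + u) := ⟨_, rfl⟩
  obtain ⟨C, hC⟩ : ∃ C, C = 2 * ν + q * (t + v) := ⟨_, rfl⟩
  have hQ₁ : (s - t) * (2 * ν + q * (s + t)) = (u - v) * Q := by
    rw [hQ]; linear_combination h₁
  have hP₁ : (s - t) * (3 * ν * (s + t) + 2 * q * (s ^ 2 + s * t + t ^ 2)) = (u - v) * P := by
    rw [hP]; linear_combination h₂
  have hBC : (s - u) * B = (t - v) * C := by
    rw [hB, hC]; linear_combination h₁
  have hXY : (s - t) * ((s - u) * X + (t - v) * Y) = 0 := by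
    have : (s - u) * X + (t - v) * Y =
        (3 * ν * (s + t) + 2 * q * (s ^ 2 + s * t + t ^ 2)) * Q
          - P * (2 * ν + q * (s + t)) := by
      rw [hX, hY, hP, hQ]; ring
    rw [this]
    linear_combination Q * hP₁ - P * hQ₁
  have hprod : ((s - t) * (s - u)) * (C * X + B * Y) = 0 := by
    linear_combination C * hXY + (s - t) * Y * hBC
  have h24 : IsUnit (24 * ν ^ 3) := by
    have h2 : IsUnit (2 : R) := isUnit_of_mul_isUnit_left (y := 3) (by norm_num; exact h6)
    have : (24 : R) * ν ^ 3 = 6 * 2 * 2 * ν ^ 3 := by ring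
    rw [this]
    exact ((h6.mul h2).mul h2).mul (hν.pow 3)
  have hu : IsUnit (C * X + B * Y) := by
    refine isUnit_of_eq_add_nilpotent_mul h24 hq (m :=
      2 * ν * (2 * (s + u + t) * Q + 3 * ν * (u + v) - P)
        + (t + v) * X
        + 2 * ν * (2 * (t + v + u) * Q + 3 * ν * (u + v) - P)
        + (s + u) * Y) ?_
    rw [hB, hC, hX, hY, hQ]
    ring
  exact (hu.mul_left_eq_zero).mp hprod

/-- The map `y ↦ 2ν y + q y²` is injective when `2ν` is a unit and `q` is nilpotent. -/
theorem eq_of_quadratic_eq {R : Type*} [CommRing R] {ν q v w : R}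
    (hν : IsUnit (2 * ν)) (hq : IsNilpotent q)
    (h : 2 * ν * v + q * v ^ 2 = 2 * ν * w + q * w ^ 2) : v = w := by
  have hu : IsUnit (2 * ν + q * (v + w)) := isUnit_of_eq_add_nilpotent_mul hν hq rfl
  refine sub_eq_zero.mp (hu.mul_left_eq_zero.mp ?_)
  linear_combination h

/-- There are at most `(c + 1) p ^ c` pairs of residues modulo `p ^ c` with product zero. -/
theorem card_zmod_mul_eq_zero_le {p : ℕ} (hp : p.Prime) (c : ℕ) :
    Nat.card {x : ZMod (p ^ c) × ZMod (p ^ c) // x.1 * x.2 = 0} ≤ (c + 1) * p ^ c := by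
  classical
  have : NeZero (p ^ c) := ⟨pow_ne_zero _ hp.ne_zero⟩
  let T : Finset (ZMod (p ^ c) × ZMod (p ^ c)) := (Finset.range (c + 1)).biUnion fun i =>
    (Finset.range (p ^ (c - i)) ×ˢ Finset.range (p ^ i)).image
      fun m => (((p ^ i * m.1 : ℕ) : ZMod (p ^ c)), ((p ^ (c - i) * m.2 : ℕ) : ZMod (p ^ c)))
  have hT : T.card ≤ (c + 1) * p ^ c := by
    refine Finset.card_biUnion_le.trans ?_
    calc _ ≤ ∑ _i ∈ Finset.range (c + 1), p ^ c := by
          refine Finset.sum_le_sum fun i hi => Finset.card_image_le.trans ?_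
          rw [Finset.card_product, Finset.card_range, Finset.card_range, ← pow_add,
            Nat.sub_add_cancel (Nat.lt_succ_iff.mp (Finset.mem_range.mp hi))]
      _ = _ := by simp
  refine le_trans ?_ hT
  rw [← Nat.card_eq_finsetCard T]
  refine Nat.card_le_card_of_injective (fun x => ⟨x.1, ?_⟩)
    fun x y h => Subtype.ext (congrArg (fun z : T => z.1) h)
  obtain ⟨⟨x, y⟩, hxy⟩ := x
  have hdvd : p ^ c ∣ x.val * y.val := by
    rw [← ZMod.natCast_eq_zero_iff]
    simpa using hxy
  obtain ⟨d, e, ⟨m, hm⟩, ⟨n, hn⟩, hde⟩ := exists_dvd_and_dvd_of_dvd_mul hdvd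
  obtain ⟨i, hi, rfl⟩ := (Nat.dvd_prime_pow hp).mp (Dvd.intro _ hde.symm)
  have he : e = p ^ (c - i) := by
    refine Nat.eq_of_mul_eq_mul_left (pow_pos hp.pos i) ?_
    rw [← hde, ← pow_add, Nat.add_sub_cancel' hi]
  subst he
  simp only [T, Finset.mem_biUnion, Finset.mem_image, Finset.mem_product, Finset.mem_range]
  refine ⟨i, Nat.lt_succ_of_le hi, (m, n), ⟨?_, ?_⟩, ?_⟩
  · refine Nat.lt_of_mul_lt_mul_left (a := p ^ i) ?_
    rw [← hm, ← hde]
    exact ZMod.val_lt x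
  · refine Nat.lt_of_mul_lt_mul_left (a := p ^ (c - i)) ?_
    rw [← hn, mul_comm, ← hde]
    exact ZMod.val_lt y
  · rw [← hm, ← hn, ZMod.natCast_zmod_val, ZMod.natCast_zmod_val]

/-- Lemma 8: for `a ≥ 1` and `c ≥ 0` one has `N(p;a,c) ≤ (c+1) · p^(2c)`. -/
theorem Ncount_le (p : ℕ) (hp : p.Prime) (hp5 : 5 ≤ p) (ν : ℤ) (hν : ¬ (p : ℤ) ∣ ν)
    (a c : ℕ) (ha : 1 ≤ a) :
    Ncount p ν a c ≤ (c + 1) * p ^ (2 * c) := by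
  have : NeZero (p ^ c) := ⟨pow_ne_zero _ hp.ne_zero⟩
  have unit_of_coprime : ∀ n : ℤ, ¬ (p : ℤ) ∣ n → IsUnit (n : ZMod (p ^ c)) := by
    intro n hn
    rw [ZMod.coe_int_isUnit_iff_isCoprime]
    push_cast
    exact ((Nat.prime_iff_prime_int.mp hp).coprime_iff_not_dvd.mpr hn).pow_left
  have hν' := unit_of_coprime ν hν
  have h2 : IsUnit (2 : ZMod (p ^ c)) := by
    have := unit_of_coprime 2 fun h => by
      have := Int.le_of_dvd (by norm_num) h
      omega
    exact_mod_cast this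
  have h3 : IsUnit (3 : ZMod (p ^ c)) := by
    have := unit_of_coprime 3 fun h => by
      have := Int.le_of_dvd (by norm_num) h
      omega
    exact_mod_cast this
  have h6 : IsUnit (6 : ZMod (p ^ c)) := by
    have := h2.mul h3
    norm_num at this
    exact this
  have hq : IsNilpotent ((p : ZMod (p ^ c)) ^ a) := by
    refine IsNilpotent.pow_of_pos ⟨c, ?_⟩ (by omega)
    exact_mod_cast ZMod.natCast_self (p ^ c)
  have hcard : Nat.card (ZMod (p ^ c) ×
      {x : ZMod (p ^ c) × ZMod (p ^ c) // x.1 * x.2 = 0}) ≤ (c + 1) * p ^ (2 * c) := by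
    rw [Nat.card_prod, Nat.card_zmod]
    calc _ ≤ p ^ c * ((c + 1) * p ^ c) :=
          Nat.mul_le_mul_left _ (card_zmod_mul_eq_zero_le hp c)
      _ = _ := by ring
  refine le_trans ?_ hcard
  refine Nat.card_le_card_of_injective
    (fun y => (y.1.1, ⟨(y.1.1 - y.1.2.2.1, y.1.1 - y.1.2.2.2),
      sub_mul_sub_eq_zero_of_system hν' h6 hq y.2.1 y.2.2⟩)) ?_
  rintro ⟨⟨s, v, t, u⟩, h, _⟩ ⟨⟨s', v', t', u'⟩, h', _⟩ hst
  simp only [Prod.mk.injEq, Subtype.mk.injEq] at hst h h' ⊢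
  obtain ⟨rfl, ht, hu⟩ := hst
  obtain rfl := sub_right_injective ht
  obtain rfl := sub_right_injective hu
  refine ⟨rfl, ?_, rfl, rfl⟩
  refine eq_of_quadratic_eq (h2.mul hν') hq ?_
  linear_combination h - h'
end

section
/- For every integer a ≥ 1 and every integer c ≥ 2 one has the recursive bound N(p;a,c) ≤ 2 p^{2c} + p^{4} · N(p;a+1,c−2). (Here 2p^{2c} bounds the number of nonsingular solutions, i.e. those quadruples for which y_1, y_2, y_7, y_8 are not all congruent modulo p, and the second term accounts for the singular solutions.) -/
theorem eq_or_swap_of_sum_eq_of_sum_sq_eq {F : Type*} [Field F] (h2 : (2 : F) ≠ 0)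
    {a b c d : F} (h1 : a + b = c + d) (hs : a ^ 2 + b ^ 2 = c ^ 2 + d ^ 2) :
    a = c ∧ b = d ∨ a = d ∧ b = c := by
  have hb : b = c + d - a := by linear_combination h1
  have h : (a - c) * (a - d) = 0 := by
    subst hb
    have : 2 * ((a - c) * (a - d)) = 0 := by linear_combination hs
    exact (mul_eq_zero.mp this).resolve_left h2
  rcases mul_eq_zero.mp h with h | h
  · left
    exact ⟨by linear_combination h, by linear_combination hb - h⟩
  · right
    exact ⟨by linear_combination h, by linear_combination hb - h⟩

/-- The pair of equations counted by `Ncount`, over an arbitrary commutative ring, with `n` in the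
role of `ν` and `q` in the role of `pᵃ`. -/
def PairEq {R : Type*} [CommRing R] (n q : R) (y : R × R × R × R) : Prop :=
  2 * n * (y.1 + y.2.1 - y.2.2.1 - y.2.2.2)
      + q * (y.1 ^ 2 + y.2.1 ^ 2 - y.2.2.1 ^ 2 - y.2.2.2 ^ 2) = 0 ∧
  3 * n * (y.1 ^ 2 + y.2.1 ^ 2 - y.2.2.1 ^ 2 - y.2.2.2 ^ 2)
      + 2 * q * (y.1 ^ 3 + y.2.1 ^ 3 - y.2.2.1 ^ 3 - y.2.2.2 ^ 3) = 0

namespace PairEq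

section LocalHom

variable {R F : Type*} [CommRing R] [Field F] {π : R →+* F} {n q : R}

theorem eq_or_swap (h2 : (2 : F) ≠ 0) (h3 : (3 : F) ≠ 0) (hn : π n ≠ 0) (hq : π q = 0)
    {y : R × R × R × R} (h : PairEq n q y) :
    π y.1 = π y.2.2.1 ∧ π y.2.1 = π y.2.2.2 ∨ π y.1 = π y.2.2.2 ∧ π y.2.1 = π y.2.2.1 := by
  have e1 := congrArg π h.1
  have e2 := congrArg π h.2
  simp only [map_add, map_sub, map_mul, map_pow, hq, map_zero, map_ofNat, zero_mul, mul_zero,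
    add_zero] at e1 e2
  have e1' := (mul_eq_zero.mp e1).resolve_left (mul_ne_zero h2 hn)
  have e2' := (mul_eq_zero.mp e2).resolve_left (mul_ne_zero h3 hn)
  exact eq_or_swap_of_sum_eq_of_sum_sq_eq h2 (by linear_combination e1')
    (by linear_combination e2')

theorem eq_of_congr (hu : ∀ r : R, π r ≠ 0 → IsUnit r) (h2 : (2 : F) ≠ 0) (h3 : (3 : F) ≠ 0)
    (hn : π n ≠ 0) (hq : π q = 0) {u₁ u₂ v₁ v₂ s t : R}
    (hU : PairEq n q (u₁, u₂, s, t)) (hV : PairEq n q (v₁, v₂, s, t))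
    (hne : π u₁ ≠ π u₂) (h₁ : π u₁ = π v₁) (h₂ : π u₂ = π v₂) : u₁ = v₁ ∧ u₂ = v₂ := by
  obtain ⟨hU1, hU2⟩ := hU
  obtain ⟨hV1, hV2⟩ := hV
  dsimp only at hU1 hU2 hV1 hV2
  set A := 2 * n + q * (u₁ + v₁) with hA
  set B := 2 * n + q * (u₂ + v₂) with hB
  set C := 3 * n * (u₁ + v₁) + 2 * q * (u₁ ^ 2 + u₁ * v₁ + v₁ ^ 2) with hC
  set D := 3 * n * (u₂ + v₂) + 2 * q * (u₂ ^ 2 + u₂ * v₂ + v₂ ^ 2) with hD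
  have e1 : A * (u₁ - v₁) + B * (u₂ - v₂) = 0 := by
    rw [hA, hB]; linear_combination hU1 - hV1
  have e2 : C * (u₁ - v₁) + D * (u₂ - v₂) = 0 := by
    rw [hC, hD]; linear_combination hU2 - hV2
  have hdet : IsUnit (A * D - B * C) := by
    apply hu
    have : π (A * D - B * C) = 2 * 2 * 3 * π n ^ 2 * (π u₂ - π u₁) := by
      rw [hA, hB, hC, hD]
      simp only [map_add, map_sub, map_mul, map_pow, hq, map_ofNat, ← h₁, ← h₂]
      ring
    rw [this]
    exact mul_ne_zero (mul_ne_zero (mul_ne_zero (mul_ne_zero h2 h2) h3) (pow_ne_zero 2 hn))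
      (sub_ne_zero.mpr hne.symm)
  constructor
  · refine sub_eq_zero.mp (hdet.mul_right_eq_zero.mp ?_)
    linear_combination D * e1 - B * e2
  · refine sub_eq_zero.mp (hdet.mul_right_eq_zero.mp ?_)
    linear_combination A * e2 - C * e1

theorem card_nonsingular_le [Finite R] (hu : ∀ r : R, π r ≠ 0 → IsUnit r) (h2 : (2 : F) ≠ 0)
    (h3 : (3 : F) ≠ 0) (hn : π n ≠ 0) (hq : π q = 0) :
    Nat.card {y : R × R × R × R // PairEq n q y ∧ π y.1 ≠ π y.2.1} ≤ 2 * Nat.card R ^ 2 := by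
  classical
  let f : {y : R × R × R × R // PairEq n q y ∧ π y.1 ≠ π y.2.1} → Bool × R × R :=
    fun y ↦ (decide (π y.1.1 = π y.1.2.2.1), y.1.2.2.1, y.1.2.2.2)
  have hf : Function.Injective f := by
    rintro ⟨⟨u₁, u₂, s, t⟩, hU, hUne⟩ ⟨⟨v₁, v₂, s', t'⟩, hV, hVne⟩ h
    simp only [f, Prod.mk.injEq, decide_eq_decide] at h
    obtain ⟨hst, rfl, rfl⟩ := h
    have hcongr : π u₁ = π v₁ ∧ π u₂ = π v₂ := by
      have h1 := hU.eq_or_swap h2 h3 hn hq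
      have h2 := hV.eq_or_swap h2 h3 hn hq
      dsimp only at h1 h2 hUne hVne
      grind
    obtain ⟨rfl, rfl⟩ := eq_of_congr hu h2 h3 hn hq hU hV hUne hcongr.1 hcongr.2
    rfl
  refine (Nat.card_le_card_of_injective f hf).trans (le_of_eq ?_)
  simp [Nat.card_prod, sq]

end LocalHom

/-- Substituting `yᵢ = x + p zᵢ` turns a solution modulo `p ^ (k + 2)` into a solution modulo
`p ^ k` of the system with `ν + x pᵃ` and `a + 1` in place of `ν` and `a`. -/
theorem descend {p ν x : ℤ} (hp : p ≠ 0) {a k : ℕ} {z : ℤ × ℤ × ℤ × ℤ}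
    (h1 : p ^ (k + 2) ∣ 2 * ν * ((x + p * z.1) + (x + p * z.2.1) - (x + p * z.2.2.1)
        - (x + p * z.2.2.2)) + p ^ a * ((x + p * z.1) ^ 2 + (x + p * z.2.1) ^ 2
        - (x + p * z.2.2.1) ^ 2 - (x + p * z.2.2.2) ^ 2))
    (h2 : p ^ (k + 2) ∣ 3 * ν * ((x + p * z.1) ^ 2 + (x + p * z.2.1) ^ 2 - (x + p * z.2.2.1) ^ 2
        - (x + p * z.2.2.2) ^ 2) + 2 * p ^ a * ((x + p * z.1) ^ 3 + (x + p * z.2.1) ^ 3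
        - (x + p * z.2.2.1) ^ 3 - (x + p * z.2.2.2) ^ 3)) :
    p ^ k ∣ 2 * (ν + x * p ^ a) * (z.1 + z.2.1 - z.2.2.1 - z.2.2.2)
        + p ^ (a + 1) * (z.1 ^ 2 + z.2.1 ^ 2 - z.2.2.1 ^ 2 - z.2.2.2 ^ 2) ∧
    p ^ k ∣ 3 * (ν + x * p ^ a) * (z.1 ^ 2 + z.2.1 ^ 2 - z.2.2.1 ^ 2 - z.2.2.2 ^ 2)
        + 2 * p ^ (a + 1) * (z.1 ^ 3 + z.2.1 ^ 3 - z.2.2.1 ^ 3 - z.2.2.2 ^ 3) := by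
  constructor
  · refine (Dvd.intro_left p (pow_succ' p k).symm).trans
      ((mul_dvd_mul_iff_left hp).mp (?_ : p * p ^ (k + 1) ∣ _))
    refine (dvd_of_eq (by ring)).trans (h1.trans (dvd_of_eq (by ring)))
  · refine (mul_dvd_mul_iff_left (pow_ne_zero 2 hp)).mp ?_
    refine (dvd_of_eq (by ring)).trans
      ((dvd_sub h2 (Dvd.dvd.mul_left h1 (3 * x))).trans (dvd_of_eq (by ring)))

theorem scale {R : Type*} [CommRing R] {n n' q l : R} (hl : l * n' = n) {z : R × R × R × R}
    (h : PairEq n' q z) : PairEq n q (l * z.1, l * z.2.1, l * z.2.2.1, l * z.2.2.2) := by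
  obtain ⟨h1, h2⟩ := h
  subst hl
  exact ⟨by dsimp only; linear_combination l ^ 2 * h1, by dsimp only; linear_combination l ^ 3 * h2⟩

end PairEq

theorem Ncount_eq_card_pairEq (p : ℕ) (ν : ℤ) (a c : ℕ) :
    Ncount p ν a c = Nat.card {y : ZMod (p ^ c) × ZMod (p ^ c) × ZMod (p ^ c) × ZMod (p ^ c) //
      PairEq (ν : ZMod (p ^ c)) ((p : ZMod (p ^ c)) ^ a) y} := rfl

theorem ZMod.isUnit_intCast_pow_of_not_dvd {p : ℕ} (hp : p.Prime) {m : ℤ} (hm : ¬ (p : ℤ) ∣ m)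
    (k : ℕ) : IsUnit (m : ZMod (p ^ k)) := by
  have h : IsCoprime m ((p : ℤ) ^ k) :=
    ((Nat.prime_iff_prime_int.mp hp).coprime_iff_not_dvd.mpr hm).symm.pow_right
  obtain ⟨u, v, huv⟩ := h
  refine .of_mul_eq_one (u : ZMod (p ^ k)) ?_
  have := congrArg (Int.cast : ℤ → ZMod (p ^ k)) huv
  have h0 : ((p : ZMod (p ^ k)) ^ k) = 0 := by exact_mod_cast ZMod.natCast_self (p ^ k)
  push_cast at this
  rw [h0] at this
  linear_combination this

theorem ZMod.isUnit_of_castHom_ne_zero {p : ℕ} (hp : p.Prime) {c : ℕ} (hc : p ∣ p ^ c)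
    (r : ZMod (p ^ c)) (hr : ZMod.castHom hc (ZMod p) r ≠ 0) : IsUnit r := by
  obtain ⟨m, rfl⟩ := ZMod.intCast_surjective r
  refine ZMod.isUnit_intCast_pow_of_not_dvd hp (fun h ↦ hr ?_) c
  rw [map_intCast]
  exact (ZMod.intCast_zmod_eq_zero_iff_dvd m p).mpr h

theorem Nat.eq_of_div_pow_eq_of_modEq {p k m n : ℕ} (hx : m % p = n % p)
    (hz : m / p ≡ n / p [MOD p ^ k]) (hd : m / p ^ (k + 1) = n / p ^ (k + 1)) : m = n := by
  rw [pow_succ', ← Nat.div_div_eq_div_mul, ← Nat.div_div_eq_div_mul] at hd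
  have : m / p = n / p := by
    rw [← Nat.div_add_mod (m / p) (p ^ k), ← Nat.div_add_mod (n / p) (p ^ k), hd, hz]
  rw [← Nat.div_add_mod m p, ← Nat.div_add_mod n p, this, hx]

theorem card_subtype_eq_add_card_not {α : Type*} [Finite α] (P Q : α → Prop) :
    Nat.card {x // P x} = Nat.card {x // P x ∧ Q x} + Nat.card {x // P x ∧ ¬ Q x} := by
  classical
  rw [← Nat.card_sum]
  exact Nat.card_congr ((Equiv.sumCompl fun x : {x // P x} ↦ Q x).symm.trans
    (Equiv.sumCongr (Equiv.subtypeSubtypeEquivSubtypeInter P Q)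
      (Equiv.subtypeSubtypeEquivSubtypeInter P fun x ↦ ¬ Q x)))

theorem castHom_facts {p : ℕ} (hp5 : 5 ≤ p) {ν : ℤ} (hν : ¬ (p : ℤ) ∣ ν)
    {a c : ℕ} (ha : 1 ≤ a) (hdvd : p ∣ p ^ c) :
    (2 : ZMod p) ≠ 0 ∧ (3 : ZMod p) ≠ 0 ∧ ZMod.castHom hdvd (ZMod p) (ν : ZMod (p ^ c)) ≠ 0 ∧
      ZMod.castHom hdvd (ZMod p) ((p : ZMod (p ^ c)) ^ a) = 0 := by
  have hsmall : ∀ m : ℕ, 0 < m → m < p → (m : ZMod p) ≠ 0 := fun m h0 hm h ↦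
    absurd (Nat.le_of_dvd h0 ((ZMod.natCast_eq_zero_iff m p).mp h)) (by lia)
  refine ⟨by exact_mod_cast hsmall 2 (by lia) (by lia),
    by exact_mod_cast hsmall 3 (by lia) (by lia), ?_, ?_⟩
  · rwa [map_intCast, Ne, ZMod.intCast_zmod_eq_zero_iff_dvd]
  · rw [map_pow, map_natCast, ZMod.natCast_self, zero_pow (by lia)]

theorem ZMod.castHom_eq_iff_val_mod {p n : ℕ} [NeZero n] (hdvd : p ∣ n) (x y : ZMod n) :
    ZMod.castHom hdvd (ZMod p) x = ZMod.castHom hdvd (ZMod p) y ↔ x.val % p = y.val % p := by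
  rw [← ZMod.natCast_eq_natCast_iff', ← map_natCast (ZMod.castHom hdvd (ZMod p)) x.val,
    ← map_natCast (ZMod.castHom hdvd (ZMod p)) y.val, ZMod.natCast_zmod_val,
    ZMod.natCast_zmod_val]

/-- The quotients `⌊yᵢ / p⌋` of a solution whose coordinates are all congruent modulo `p` solve
the system modulo `p ^ k` with `ν` shifted and `a` increased by one. -/
theorem PairEq.div_of_congr {p : ℕ} (hp : p.Prime) {ν : ℤ} {a k : ℕ}
    {y : ZMod (p ^ (k + 2)) × ZMod (p ^ (k + 2)) × ZMod (p ^ (k + 2)) × ZMod (p ^ (k + 2))}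
    (h : PairEq (ν : ZMod (p ^ (k + 2))) ((p : ZMod (p ^ (k + 2))) ^ a) y)
    (h2 : y.2.1.val % p = y.1.val % p) (h3 : y.2.2.1.val % p = y.1.val % p)
    (h4 : y.2.2.2.val % p = y.1.val % p) :
    PairEq ((ν : ZMod (p ^ k)) + (y.1.val % p : ℕ) * (p : ZMod (p ^ k)) ^ a)
      ((p : ZMod (p ^ k)) ^ (a + 1))
      (((y.1.val / p : ℕ) : ZMod (p ^ k)), ((y.2.1.val / p : ℕ) : ZMod (p ^ k)),
        ((y.2.2.1.val / p : ℕ) : ZMod (p ^ k)), ((y.2.2.2.val / p : ℕ) : ZMod (p ^ k))) := by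
  have : NeZero (p ^ (k + 2)) := ⟨pow_ne_zero _ hp.ne_zero⟩
  obtain ⟨y₁, y₂, y₃, y₄⟩ := y
  dsimp only at h2 h3 h4 ⊢
  have hval : ∀ u : ZMod (p ^ (k + 2)), u.val % p = y₁.val % p →
      u = (((y₁.val % p : ℕ) + (p : ℤ) * (u.val / p : ℕ) : ℤ) : ZMod (p ^ (k + 2))) := by
    intro u hu
    rw [← hu]
    have : ((u.val % p : ℕ) + (p : ℤ) * (u.val / p : ℕ) : ℤ) = (u.val : ℤ) := by
      exact_mod_cast Nat.mod_add_div u.val p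
    rw [this, Int.cast_natCast, ZMod.natCast_zmod_val]
  obtain ⟨e1, e2⟩ := h
  dsimp only at e1 e2
  rw [hval y₁ rfl, hval y₂ h2, hval y₃ h3, hval y₄ h4] at e1 e2
  generalize y₁.val % p = x at *
  generalize y₁.val / p = z₁ at *
  generalize y₂.val / p = z₂ at *
  generalize y₃.val / p = z₃ at *
  generalize y₄.val / p = z₄ at *
  have hdvd : ∀ (j : ℕ) (m : ℤ), (p : ℤ) ^ j ∣ m ↔ (m : ZMod (p ^ j)) = 0 := fun j m ↦ by
    rw [ZMod.intCast_zmod_eq_zero_iff_dvd, Nat.cast_pow]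
  have d := PairEq.descend (p := p) (ν := ν) (x := x) (by exact_mod_cast hp.ne_zero) (a := a)
    (k := k) (z := (z₁, z₂, z₃, z₄))
    ((hdvd _ _).mpr (by push_cast at e1 ⊢; exact e1))
    ((hdvd _ _).mpr (by push_cast at e2 ⊢; exact e2))
  rw [hdvd, hdvd] at d
  push_cast at d
  exact d

theorem card_singular_pairEq_le {p : ℕ} (hp : p.Prime) (hp5 : 5 ≤ p) {ν : ℤ}
    (hν : ¬ (p : ℤ) ∣ ν) {a k : ℕ} (ha : 1 ≤ a) (hdvd : p ∣ p ^ (k + 2)) :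
    Nat.card {y : ZMod (p ^ (k + 2)) × ZMod (p ^ (k + 2)) × ZMod (p ^ (k + 2)) ×
        ZMod (p ^ (k + 2)) // PairEq (ν : ZMod (p ^ (k + 2))) ((p : ZMod (p ^ (k + 2))) ^ a) y ∧
        ¬ ZMod.castHom hdvd (ZMod p) y.1 ≠ ZMod.castHom hdvd (ZMod p) y.2.1} ≤
      p ^ 4 * Ncount p ν (a + 1) k := by
  have : NeZero (p ^ (k + 2)) := ⟨pow_ne_zero _ hp.ne_zero⟩
  have : NeZero (p ^ k) := ⟨pow_ne_zero _ hp.ne_zero⟩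
  have : Fact p.Prime := ⟨hp⟩
  obtain ⟨h2, h3, hn, hq⟩ := castHom_facts hp5 hν ha hdvd
  have hl : ∀ x : ℕ, ∃ l : ZMod (p ^ k), l * ((ν : ZMod (p ^ k)) + x * (p : ZMod (p ^ k)) ^ a) =
      (ν : ZMod (p ^ k)) := by
    intro x
    have hx : ¬ (p : ℤ) ∣ ν + x * (p : ℤ) ^ a := fun h ↦ hν <|
      (dvd_add_left (Dvd.dvd.mul_left (dvd_pow_self _ (by lia)) _)).mp h
    obtain ⟨r, hr⟩ := (ZMod.isUnit_intCast_pow_of_not_dvd hp hx k).exists_left_inv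
    push_cast at hr
    exact ⟨ν * r, by rw [mul_assoc, hr, mul_one]⟩
  choose l hl using hl
  have hsing : ∀ y : {y : ZMod (p ^ (k + 2)) × ZMod (p ^ (k + 2)) × ZMod (p ^ (k + 2)) ×
      ZMod (p ^ (k + 2)) // PairEq (ν : ZMod (p ^ (k + 2))) ((p : ZMod (p ^ (k + 2))) ^ a) y ∧
      ¬ ZMod.castHom hdvd (ZMod p) y.1 ≠ ZMod.castHom hdvd (ZMod p) y.2.1},
      y.1.2.1.val % p = y.1.1.val % p ∧ y.1.2.2.1.val % p = y.1.1.val % p ∧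
        y.1.2.2.2.val % p = y.1.1.val % p := by
    rintro ⟨y, hy, hs⟩
    have h := hy.eq_or_swap h2 h3 hn hq
    simp only [← ZMod.castHom_eq_iff_val_mod hdvd]
    grind
  have hdigit : ∀ u : ZMod (p ^ (k + 2)), u.val / p ^ (k + 1) < p := fun u ↦
    Nat.div_lt_of_lt_mul (by rw [← pow_succ]; exact u.val_lt)
  rw [Ncount_eq_card_pairEq]
  let f : {y : ZMod (p ^ (k + 2)) × ZMod (p ^ (k + 2)) × ZMod (p ^ (k + 2)) ×
      ZMod (p ^ (k + 2)) // PairEq (ν : ZMod (p ^ (k + 2))) ((p : ZMod (p ^ (k + 2))) ^ a) y ∧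
      ¬ ZMod.castHom hdvd (ZMod p) y.1 ≠ ZMod.castHom hdvd (ZMod p) y.2.1} →
      (Fin p × Fin p × Fin p × Fin p) ×
      {w : ZMod (p ^ k) × ZMod (p ^ k) × ZMod (p ^ k) × ZMod (p ^ k) //
        PairEq (ν : ZMod (p ^ k)) ((p : ZMod (p ^ k)) ^ (a + 1)) w} := fun y ↦
    ((⟨y.1.1.val % p, Nat.mod_lt _ hp.pos⟩, ⟨y.1.1.val / p ^ (k + 1), hdigit _⟩,
      ⟨y.1.2.2.1.val / p ^ (k + 1), hdigit _⟩, ⟨y.1.2.2.2.val / p ^ (k + 1), hdigit _⟩),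
      ⟨_, (y.2.1.div_of_congr hp (hsing y).1 (hsing y).2.1 (hsing y).2.2).scale
        (hl (y.1.1.val % p))⟩)
  have hcancel : ∀ (x m n : ℕ), l x * (m : ZMod (p ^ k)) = l x * (n : ZMod (p ^ k)) →
      m ≡ n [MOD p ^ k] := by
    intro x m n h
    rw [← ZMod.natCast_eq_natCast_iff]
    refine (ZMod.isUnit_intCast_pow_of_not_dvd hp hν k).mul_left_cancel ?_
    rw [← hl x]
    linear_combination ((ν : ZMod (p ^ k)) + x * (p : ZMod (p ^ k)) ^ a) * h
  have hf : Function.Injective f := by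
    intro u v h
    have hu := hsing u
    have hv := hsing v
    obtain ⟨⟨u₁, u₂, u₃, u₄⟩, hU, hUs⟩ := u
    obtain ⟨⟨v₁, v₂, v₃, v₄⟩, hV, hVs⟩ := v
    simp only [f, Prod.mk.injEq, Fin.mk.injEq, Subtype.mk.injEq] at h
    dsimp only at hu hv
    obtain ⟨⟨hx, hd1, hd3, hd4⟩, hw1, -, hw3, hw4⟩ := h
    rw [hx] at hw1 hw3 hw4
    obtain rfl : u₁ = v₁ := ZMod.val_injective _
      (Nat.eq_of_div_pow_eq_of_modEq hx (hcancel _ _ _ hw1) hd1)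
    obtain rfl : u₃ = v₃ := ZMod.val_injective _
      (Nat.eq_of_div_pow_eq_of_modEq (hu.2.1.trans hv.2.1.symm) (hcancel _ _ _ hw3) hd3)
    obtain rfl : u₄ = v₄ := ZMod.val_injective _
      (Nat.eq_of_div_pow_eq_of_modEq (hu.2.2.trans hv.2.2.symm) (hcancel _ _ _ hw4) hd4)
    have hunit : IsUnit (2 * (ν : ZMod (p ^ (k + 2))) + (p : ZMod (p ^ (k + 2))) ^ a *
        (u₂ + v₂)) := by
      apply ZMod.isUnit_of_castHom_ne_zero hp hdvd
      rw [map_add, map_mul, map_mul _ (_ ^ a), hq, zero_mul, add_zero, map_ofNat]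
      exact mul_ne_zero h2 hn
    obtain rfl : u₂ = v₂ := by
      refine sub_eq_zero.mp (hunit.mul_right_eq_zero.mp ?_)
      have e1 := hU.1
      have e2 := hV.1
      dsimp only at e1 e2
      linear_combination e1 - e2
    rfl
  refine (Nat.card_le_card_of_injective f hf).trans (le_of_eq ?_)
  simp only [Nat.card_prod, Nat.card_fin]
  ring

/-- The recursive bound in the proof of Lemma 8: for `a ≥ 1` and `c ≥ 2`,
`N(p;a,c) ≤ 2p^(2c) + p⁴ · N(p;a+1,c−2)`. -/
theorem Ncount_recursive (p : ℕ) (hp : p.Prime) (hp5 : 5 ≤ p) (ν : ℤ) (hν : ¬ (p : ℤ) ∣ ν)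
    (a c : ℕ) (ha : 1 ≤ a) (hc : 2 ≤ c) :
    Ncount p ν a c ≤ 2 * p ^ (2 * c) + p ^ 4 * Ncount p ν (a + 1) (c - 2) := by
  obtain ⟨k, rfl⟩ := Nat.exists_eq_add_of_le' hc
  have : NeZero (p ^ (k + 2)) := ⟨pow_ne_zero _ hp.ne_zero⟩
  have : Fact p.Prime := ⟨hp⟩
  have hdvd : p ∣ p ^ (k + 2) := dvd_pow_self p (by lia)
  obtain ⟨h2, h3, hn, hq⟩ := castHom_facts hp5 hν ha hdvd
  have hns := PairEq.card_nonsingular_le (ZMod.isUnit_of_castHom_ne_zero hp hdvd) h2 h3 hn hq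
  have hs := card_singular_pairEq_le hp hp5 hν (k := k) ha hdvd
  rw [Nat.card_zmod, ← pow_mul, mul_comm (k + 2) 2] at hns
  rw [Ncount_eq_card_pairEq, Nat.add_sub_cancel]
  refine le_trans (le_of_eq ?_) (Nat.add_le_add hns hs)
  exact card_subtype_eq_add_card_not _ _
end
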